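/- arXiv:2002.00921 — 5 statements merged into one kernel-verified Lean document; each statement's English description precedes it below -/
import Mathlib

section
/- For any tree T with m ≥ 1 edges, there exist an integer k' ≥ 2, a constant c > 0 and n₀ such that for all n ≥ n₀, f_{k'}(n,T) ≤ c·n^{(m+1)/m}. -/
open Finset

/-- `c` is a proper edge colouring of the complete graph on `Fin n`:
it is symmetric and edges sharing a vertex receive distinct colours. -/
def IsProperEdgeColoring (n : ℕ) (c : Fin n → Fin n → ℕ) : Prop :=
  (∀ a b, c a b = c b a) ∧
    ∀ a b b', a ≠ b → a ≠ b' → b ≠ b' → c a b ≠ c a b'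

/-- The number of colours used by `c` on the edges of the complete graph on `Fin n`. -/
def numColors (n : ℕ) (c : Fin n → Fin n → ℕ) : ℕ :=
  ((Finset.univ.filter fun p : Fin n × Fin n => p.1 ≠ p.2).image fun p => c p.1 p.2).card

/-- The edge colouring `c` of the complete graph on `Fin n` contains `k` pairwise
vertex-disjoint, pairwise colour-isomorphic copies of `H`. -/
def HasRepeat (n k : ℕ) {V : Type*} (H : SimpleGraph V) (c : Fin n → Fin n → ℕ) : Prop :=
  ∃ φ : Fin k → V → Fin n,
    (∀ i, Function.Injective (φ i)) ∧
    (∀ i j, i ≠ j → ∀ u v, φ i u ≠ φ j v) ∧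
    (∀ i j, ∀ u v, H.Adj u v → c (φ i u) (φ i v) = c (φ j u) (φ j v))

/-- `repeatNumber k n H` is `f_k(n,H)`: the smallest number of colours `C` such that there
is a proper edge colouring of `K_n` with `C` colours containing no `k` pairwise
vertex-disjoint, pairwise colour-isomorphic copies of `H`. -/
noncomputable def repeatNumber (k n : ℕ) {V : Type*} (H : SimpleGraph V) : ℕ :=
  sInf { C | ∃ c : Fin n → Fin n → ℕ,
    IsProperEdgeColoring n c ∧ numColors n c = C ∧ ¬ HasRepeat n k H c }

/-- The monomial `∏ j, x j ^ e j` in the elements `x j` of a commutative ring. -/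
def monom {A κ : Type*} [CommRing A] [Fintype κ] (x : κ → A) (e : κ → ℕ) : A :=
  ∏ j, x j ^ e j

/-- The span of the monomials with exponent at most `d`. -/
def spanLE (K : Type*) {A κ : Type*} [Field K] [CommRing A] [Algebra K A] [Fintype κ]
    (x : κ → A) (d : κ → ℕ) : Submodule K A :=
  Submodule.span K (monom x '' Set.Iic d)

/-- The span of the monomials with exponent strictly below `d`. -/
def spanLT (K : Type*) {A κ : Type*} [Field K] [CommRing A] [Algebra K A] [Fintype κ]
    (x : κ → A) (d : κ → ℕ) : Submodule K A :=
  Submodule.span K (monom x '' Set.Iio d)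

section Monomials

variable {K A κ : Type*} [Field K] [CommRing A] [Algebra K A] [Fintype κ] (x : κ → A)

lemma monom_zero : monom x 0 = 1 := by simp [monom]

lemma monom_add (d e : κ → ℕ) : monom x (d + e) = monom x d * monom x e := by
  simp [monom, pow_add, Finset.prod_mul_distrib]

lemma monom_single [DecidableEq κ] (j : κ) (k : ℕ) : monom x (Pi.single j k) = x j ^ k := by
  rw [monom, Finset.prod_eq_single j]
  · simp
  · intro i _ hi
    simp [hi]
  · simp

lemma monom_mem_spanLE {d e : κ → ℕ} (h : e ≤ d) : monom x e ∈ spanLE K x d :=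
  Submodule.subset_span ⟨e, h, rfl⟩

lemma monom_mem_spanLT {d e : κ → ℕ} (h : e < d) : monom x e ∈ spanLT K x d :=
  Submodule.subset_span ⟨e, h, rfl⟩

lemma spanLE_mono {d e : κ → ℕ} (h : d ≤ e) : spanLE K x d ≤ spanLE K x e :=
  Submodule.span_mono (Set.image_mono (Set.Iic_subset_Iic.2 h))

lemma one_mem_spanLE (d : κ → ℕ) : (1 : A) ∈ spanLE K x d := by
  rw [← monom_zero x]
  exact monom_mem_spanLE x (fun _ => Nat.zero_le _)

lemma algebraMap_mem_spanLE (r : K) (d : κ → ℕ) : algebraMap K A r ∈ spanLE K x d := by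
  rw [Algebra.algebraMap_eq_smul_one]
  exact Submodule.smul_mem _ _ (one_mem_spanLE x d)

lemma mul_mem_spanLE {d e : κ → ℕ} {f g : A} (hf : f ∈ spanLE K x d) (hg : g ∈ spanLE K x e) :
    f * g ∈ spanLE K x (d + e) := by
  have h := Submodule.mul_mem_mul hf hg
  rw [spanLE, spanLE, Submodule.span_mul_span] at h
  refine Submodule.span_mono ?_ h
  rintro _ ⟨_, ⟨p, hp, rfl⟩, _, ⟨r, hr, rfl⟩, rfl⟩
  exact ⟨p + r, Set.mem_Iic.2 (add_le_add (Set.mem_Iic.1 hp) (Set.mem_Iic.1 hr)), monom_add x p r⟩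

lemma mul_mem_spanLT {d e : κ → ℕ} {f g : A} (hf : f ∈ spanLE K x d) (hg : g ∈ spanLT K x e) :
    f * g ∈ spanLT K x (d + e) := by
  have h := Submodule.mul_mem_mul hf hg
  rw [spanLE, spanLT, Submodule.span_mul_span] at h
  refine Submodule.span_mono ?_ h
  rintro _ ⟨_, ⟨p, hp, rfl⟩, _, ⟨r, hr, rfl⟩, rfl⟩
  exact ⟨p + r, Set.mem_Iio.2 (add_lt_add_of_le_of_lt (Set.mem_Iic.1 hp) (Set.mem_Iio.1 hr)),
    monom_add x p r⟩

variable [DecidableEq κ]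

lemma sub_algebraMap_mem_spanLE (j : κ) (r : K) :
    x j - algebraMap K A r ∈ spanLE K x (Pi.single j 1) := by
  refine Submodule.sub_mem _ ?_ (algebraMap_mem_spanLE x r _)
  have := monom_mem_spanLE (K := K) x (le_refl (Pi.single j 1))
  rwa [monom_single, pow_one] at this

omit [DecidableEq κ] in
lemma prod_mem_spanLE {ι : Type*} (s : Finset ι) (f : ι → A) (d : ι → κ → ℕ)
    (h : ∀ i ∈ s, f i ∈ spanLE K x (d i)) : ∏ i ∈ s, f i ∈ spanLE K x (∑ i ∈ s, d i) := by
  classical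
  induction s using Finset.induction_on with
  | empty => simpa using one_mem_spanLE x 0
  | insert i s hi ih =>
    rw [Finset.prod_insert hi, Finset.sum_insert hi]
    exact mul_mem_spanLE x (h i (Finset.mem_insert_self i s))
      (ih fun k hk => h k (Finset.mem_insert_of_mem hk))

lemma prod_sub_prod_mem_spanLT (S : Finset κ) (a : κ → K) :
    ∏ j ∈ S, (x j - algebraMap K A (a j)) - ∏ j ∈ S, x j ∈
      spanLT K x (∑ j ∈ S, Pi.single j 1) := by
  induction S using Finset.induction_on with
  | empty => simp
  | insert k S hk ih =>
    rw [Finset.prod_insert hk, Finset.prod_insert hk, Finset.sum_insert hk]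
    have h1 : x k * (∏ j ∈ S, (x j - algebraMap K A (a j)) - ∏ j ∈ S, x j) ∈
        spanLT K x (Pi.single k 1 + ∑ j ∈ S, Pi.single j 1) := by
      refine mul_mem_spanLT x ?_ ih
      simpa using sub_algebraMap_mem_spanLE x k (0 : K)
    have h2 : algebraMap K A (a k) * ∏ j ∈ S, (x j - algebraMap K A (a j)) ∈
        spanLT K x (Pi.single k 1 + ∑ j ∈ S, Pi.single j 1) := by
      rw [← Algebra.smul_def]
      refine Submodule.smul_mem _ _ ?_
      refine Submodule.span_mono (Set.image_mono ?_)
        (prod_mem_spanLE x S _ (fun j => Pi.single j 1)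
          fun j _ => sub_algebraMap_mem_spanLE x j (a j))
      intro e he
      refine lt_of_le_of_lt (Set.mem_Iic.1 he) ?_
      refine lt_add_of_pos_left _ ?_
      rw [Pi.lt_def]
      exact ⟨fun _ => Nat.zero_le _, k, by simp⟩
    have := Submodule.sub_mem _ h1 h2
    convert this using 1
    ring

/-- If `x j - a i j` for fixed `j` are pairwise coprime, then the products over fewer than
`#I` indices `j` generate the unit ideal, with coefficients of controlled degree. -/
lemma one_mem_of_forall_mul_prod_mem {ι : Type*} [Fintype ι] (a : ι → κ → K)
    (ha : ∀ j, Function.Injective fun i => a i j) (J : Finset κ) (I : Finset ι)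
    (hJI : J.card < I.card) (N : Submodule K A)
    (hN : ∀ i ∈ I, ∀ h ∈ spanLE K x (∑ j ∈ J, Pi.single j (Fintype.card ι)),
      h * ∏ j ∈ J, (x j - algebraMap K A (a i j)) ∈ N) : 1 ∈ N := by
  classical
  induction J using Finset.induction_on generalizing I N with
  | empty =>
    obtain ⟨i, hi⟩ := Finset.card_pos.1 (by simpa using hJI)
    simpa using hN i hi 1 (one_mem_spanLE x _)
  | insert k J hk ih =>
    rw [Finset.card_insert_of_notMem hk] at hJI
    have hne : I.Nonempty := Finset.card_pos.1 (by omega)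
    have hsum := congrArg (Polynomial.aeval (x k))
      (Lagrange.sum_basis (v := fun i => a i k) ((ha k).injOn (s := (I : Set ι))) hne)
    rw [map_sum, map_one] at hsum
    rw [← hsum]
    refine Submodule.sum_mem _ fun i₀ hi₀ => ?_
    set B := Polynomial.aeval (x k) (Lagrange.basis I (fun i => a i k) i₀) with hB
    have hmem := ih (I.erase i₀) (by rw [Finset.card_erase_of_mem hi₀]; omega)
      (N.comap (LinearMap.mulLeft K B)) ?_
    · simpa using hmem
    intro i hi h hh
    rw [Submodule.mem_comap, LinearMap.mulLeft_apply]
    let c : ι → K := fun i' => (a i₀ k - a i' k)⁻¹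
    have hBprod : B = ∏ i' ∈ I.erase i₀,
        (algebraMap K A (c i') * (x k - algebraMap K A (a i' k))) := by
      simp [hB, Lagrange.basis, Lagrange.basisDivisor, c, map_prod]
    set g := algebraMap K A (c i) * ∏ i' ∈ (I.erase i₀).erase i,
        (algebraMap K A (c i') * (x k - algebraMap K A (a i' k))) with hg
    have hBg : B = g * (x k - algebraMap K A (a i k)) := by
      rw [hBprod, ← Finset.mul_prod_erase _ _ hi, hg]
      ring
    have hgmem : g ∈ spanLE K x (Pi.single k (Fintype.card ι)) := by
      rw [hg, ← Algebra.smul_def]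
      refine Submodule.smul_mem _ _ ?_
      refine spanLE_mono x ?_ (prod_mem_spanLE x _ _ (fun _ => Pi.single k 1) fun i' _ => ?_)
      · rw [Finset.sum_const, ← Pi.single_smul]
        refine Pi.single_le_single.2 ?_
        simpa using Finset.card_le_univ _
      · rw [← Algebra.smul_def]
        exact Submodule.smul_mem _ _ (sub_algebraMap_mem_spanLE x k _)
    have := hN i (Finset.mem_of_mem_erase hi) (g * h) (by
      rw [Finset.sum_insert hk]
      exact mul_mem_spanLE x hgmem hh)
    rw [Finset.prod_insert hk] at this
    rw [hBg]
    convert this using 1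
    ring

/-- A long gap among exponents: if some `e k` is at least `card κ * D`, then some threshold
separates the values of `e` into two parts at distance more than `D`. -/
lemma exists_threshold (D : ℕ) (hD : 0 < D) (e : κ → ℕ) (k : κ)
    (hk : Fintype.card κ * D ≤ e k) :
    ∃ t, 0 < t ∧ t ≤ e k ∧ ∀ j, e j < t → e j + D < t := by
  have hk' : Fintype.card κ ≤ e k / D := (Nat.le_div_iff_mul_le hD).2 hk
  obtain ⟨r, hr, hr'⟩ : ∃ r ∈ Finset.range (Fintype.card κ),
      r ∉ (Finset.univ.erase k).image fun j => e j / D := by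
    apply Finset.exists_mem_notMem_of_card_lt_card
    refine Finset.card_image_le.trans_lt ?_
    rw [Finset.card_erase_of_mem (Finset.mem_univ k), Finset.card_range, Finset.card_univ]
    have : 0 < Fintype.card κ := Fintype.card_pos_iff.2 ⟨k⟩
    omega
  rw [Finset.mem_range] at hr
  refine ⟨(r + 1) * D, by positivity, ?_, fun j hj => ?_⟩
  · exact (Nat.mul_le_mul_right D hr).trans hk
  · have h1 : e j / D < r + 1 := (Nat.div_lt_iff_lt_mul hD).2 hj
    have hjk : j ≠ k := by
      rintro rfl
      omega
    have h2 : e j / D ≠ r := fun h =>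
      hr' (Finset.mem_image.2 ⟨j, Finset.mem_erase.2 ⟨hjk, Finset.mem_univ j⟩, h⟩)
    have h3 : e j < r * D := (Nat.div_lt_iff_lt_mul hD).1 (by omega)
    rw [Nat.add_mul]
    omega

/-- If the products `∏ j, (x j - a i j)` are scalars, then every monomial in the `x j` is a
combination of monomials of bounded exponent. -/
lemma monom_mem_span_of_prod_eq {ι : Type*} [Fintype ι] (hcard : Fintype.card ι = Fintype.card κ)
    (a : ι → κ → K) (ha : ∀ j, Function.Injective fun i => a i j) (b : ι → K)
    (hx : ∀ i, ∏ j, (x j - algebraMap K A (a i j)) = algebraMap K A (b i)) (e : κ → ℕ) :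
    monom x e ∈ Submodule.span K (monom x ''
      {g | ∀ j, g j < Fintype.card κ * (Fintype.card κ + 1)}) := by
  set m := Fintype.card κ with hm
  set N := Submodule.span K (monom x '' {g : κ → ℕ | ∀ j, g j < m * (m + 1)}) with hN
  induction hw : ∑ j, (m + 1) ^ e j using Nat.strong_induction_on generalizing e with
  | _ w ih =>
  by_cases he : ∀ j, e j < m * (m + 1)
  · exact Submodule.subset_span ⟨e, he, rfl⟩
  push Not at he
  obtain ⟨k, hk⟩ := he
  obtain ⟨t, ht0, htk, ht⟩ := exists_threshold (m + 1) (Nat.succ_pos m) e k hk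
  set S := Finset.univ.filter fun j => t ≤ e j with hS
  have hkS : k ∈ S := by simp [hS, htk]
  set oS : κ → ℕ := ∑ j ∈ S, Pi.single j 1 with hoS
  have hsum : ∀ (s : Finset κ) (c : ℕ) (j : κ),
      (∑ i ∈ s, Pi.single i c : κ → ℕ) j = if j ∈ s then c else 0 := by
    intro s c j
    rw [Finset.sum_apply]
    simp [Pi.single_apply]
  have hSe : oS ≤ e := by
    intro j
    rw [hoS, hsum]
    split_ifs with h
    · exact Nat.lt_of_lt_of_le ht0 (Finset.mem_filter.1 h).2
    · exact Nat.zero_le _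
  obtain ⟨e', he'⟩ : ∃ e', e = e' + oS := ⟨e - oS, (tsub_add_cancel_of_le hSe).symm⟩
  set top : κ → ℕ := e' + (∑ j ∈ Sᶜ, Pi.single j m + ∑ j ∈ Sᶜ, Pi.single j 1) with htop
  have key : ∀ f ∈ spanLE K x top, ∀ g ∈ spanLT K x oS, f * g ∈ N := by
    intro f hf g hg
    have h := Submodule.mul_mem_mul hf hg
    rw [spanLE, spanLT, Submodule.span_mul_span] at h
    refine Submodule.span_le.2 ?_ h
    rintro _ ⟨_, ⟨p, hp, rfl⟩, _, ⟨r, hr, rfl⟩, rfl⟩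
    rw [Set.mem_Iic] at hp
    rw [Set.mem_Iio, Pi.lt_def] at hr
    obtain ⟨hr, l, hl⟩ := hr
    have hlS : l ∈ S := by
      by_contra h
      rw [hoS, hsum, if_neg h] at hl
      omega
    show monom x p * monom x r ∈ N
    rw [← monom_add]
    refine ih _ ?_ (p + r) rfl
    rw [← hw]
    have hval : ∀ j, p j + r j ≤ if j ∈ S then e j else e j + (m + 1) := by
      intro j
      have h1 := hp j
      have h2 := hr j
      have h3 := congrFun he' j
      simp only [htop, Pi.add_apply, hoS, hsum, Finset.mem_compl] at h1 h2 h3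
      split_ifs at h1 h2 h3 ⊢ <;> omega
    have hvl : p l + r l + 1 ≤ e l := by
      have h1 := hp l
      have h3 := congrFun he' l
      simp only [htop, Pi.add_apply, hoS, hsum, Finset.mem_compl] at h1 hl h3
      simp only [hlS, not_true_eq_false, if_true, if_false] at h1 hl h3
      omega
    have htl : t ≤ e l := (Finset.mem_filter.1 hlS).2
    have hb : ∀ j, (m + 1) ^ (p j + r j) ≤
        (if j = l then 0 else (m + 1) ^ e j) + (m + 1) ^ (e l - 1) := by
      intro j
      have h1 := hval j
      split_ifs with h2
      · subst h2
        rw [zero_add]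
        exact Nat.pow_le_pow_right (Nat.succ_pos m) (by omega)
      · split_ifs at h1 with h3
        · exact (Nat.pow_le_pow_right (Nat.succ_pos m) h1).trans (Nat.le_add_right _ _)
        · have h4 : e j + (m + 1) < t := ht j (by simpa [hS] using h3)
          exact (Nat.pow_le_pow_right (Nat.succ_pos m) (by omega)).trans (Nat.le_add_left _ _)
    calc ∑ j, (m + 1) ^ (p + r) j
        ≤ ∑ j, ((if j = l then 0 else (m + 1) ^ e j) + (m + 1) ^ (e l - 1)) :=
          Finset.sum_le_sum fun j _ => hb j
      _ = ∑ j ∈ Finset.univ.erase l, (m + 1) ^ e j + m * (m + 1) ^ (e l - 1) := by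
          rw [Finset.sum_add_distrib, Finset.sum_const, Finset.card_univ, ← hm, smul_eq_mul,
            ← Finset.add_sum_erase _ _ (Finset.mem_univ l), if_pos rfl, zero_add]
          congr 1
          exact Finset.sum_congr rfl fun j hj => if_neg (Finset.ne_of_mem_erase hj)
      _ < ∑ j ∈ Finset.univ.erase l, (m + 1) ^ e j + (m + 1) ^ e l := by
          refine Nat.add_lt_add_left ?_ _
          obtain ⟨s, hs⟩ : ∃ s, e l = s + 1 := ⟨e l - 1, by omega⟩
          rw [hs, Nat.add_sub_cancel, pow_succ, mul_comm]
          exact Nat.mul_lt_mul_of_pos_left (Nat.lt_succ_self m) (by positivity)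
      _ = ∑ j, (m + 1) ^ e j := Finset.sum_erase_add _ _ (Finset.mem_univ l)
  have honeLT : (1 : A) ∈ spanLT K x oS := by
    rw [← monom_zero x]
    refine monom_mem_spanLT x ?_
    rw [Pi.lt_def]
    exact ⟨fun _ => Nat.zero_le _, k, by rw [hoS, hsum, if_pos hkS]; simp⟩
  have hmonS : monom x oS = ∏ j ∈ S, x j := by
    have : ∀ j, x j ^ oS j = if j ∈ S then x j else 1 := by
      intro j
      rw [hoS, hsum]
      split_ifs <;> simp
    simp [monom, this]
  have hcardS : Sᶜ.card < (Finset.univ : Finset ι).card := by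
    rw [Finset.card_univ, hcard, Finset.card_compl]
    have : 0 < S.card := Finset.card_pos.2 ⟨k, hkS⟩
    have := S.card_le_univ
    omega
  have hone := one_mem_of_forall_mul_prod_mem x a ha Sᶜ Finset.univ hcardS
    (N.comap (LinearMap.mulLeft K (monom x e))) ?_
  · simpa using hone
  intro i _ h hh
  rw [hcard] at hh
  rw [Submodule.mem_comap, LinearMap.mulLeft_apply, he', monom_add, hmonS]
  set u := ∏ j ∈ Sᶜ, (x j - algebraMap K A (a i j)) with hu
  have hsplit : (∏ j ∈ S, (x j - algebraMap K A (a i j))) * u = algebraMap K A (b i) := by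
    rw [hu, Finset.prod_mul_prod_compl, hx]
  have hR := prod_sub_prod_mem_spanLT x S (a i)
  set R := ∏ j ∈ S, (x j - algebraMap K A (a i j)) - ∏ j ∈ S, x j with hRdef
  have hmain : monom x e' * (∏ j ∈ S, x j) * (h * u) =
      b i • (monom x e' * h * 1) - monom x e' * (h * u) * R := by
    rw [Algebra.smul_def, ← hsplit, hRdef]
    ring
  have humem : u ∈ spanLE K x (∑ j ∈ Sᶜ, Pi.single j 1) :=
    prod_mem_spanLE x _ _ _ fun j _ => sub_algebraMap_mem_spanLE x j (a i j)
  have he'mem := monom_mem_spanLE (K := K) x (le_refl e')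
  rw [hmain]
  refine Submodule.sub_mem _ (Submodule.smul_mem _ _ ?_) (key _ ?_ _ hR)
  · have := key _ (mul_mem_spanLE x he'mem (mul_mem_spanLE x hh (one_mem_spanLE x _))) 1 honeLT
    simpa using this
  · exact mul_mem_spanLE x he'mem (mul_mem_spanLE x hh humem)

end Monomials

/-- A norm-type system of `m` equations in `m` unknowns has boundedly many solutions. -/
lemma card_le_of_prod_sub_eq {K ι κ : Type*} [Field K] [Fintype ι] [Fintype κ] [DecidableEq κ]
    (hcard : Fintype.card ι = Fintype.card κ) (P : Finset K) (x : κ → K → K) (j₀ : κ)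
    (hj₀ : ∀ y, x j₀ y = y) (a : ι → κ → K) (ha : ∀ j, Function.Injective fun i => a i j)
    (b : ι → K) (hx : ∀ y ∈ P, ∀ i, ∏ j, (x j y - a i j) = b i) :
    P.card ≤ (Fintype.card κ * (Fintype.card κ + 1)) ^ Fintype.card κ := by
  classical
  set M := Fintype.card κ * (Fintype.card κ + 1) with hM
  let X : κ → (P → K) := fun j y => x j y
  have hmem := monom_mem_span_of_prod_eq (K := K) X hcard a ha b (by
    intro i
    funext y
    simpa [X] using hx y y.2 i)
  set B : Finset (P → K) := (Fintype.piFinset fun _ : κ => Finset.range M).image (monom X) with hB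
  have hBset : (monom X '' {g | ∀ j, g j < M}) = B := by
    ext f
    simp [hB]
  rw [← hM, hBset] at hmem
  have htop : Submodule.span K (B : Set (P → K)) = ⊤ := by
    rw [eq_top_iff]
    intro f _
    let F : K → K := fun y => if h : y ∈ P then f ⟨y, h⟩ else 0
    have hf : f = Polynomial.aeval (X j₀) (Lagrange.interpolate P id F) := by
      funext y
      have h1 : Polynomial.aeval (X j₀) (Lagrange.interpolate P id F) y =
          (Lagrange.interpolate P id F).eval (X j₀ y) := by
        have := Polynomial.aeval_algHom_apply (Pi.evalAlgHom K (fun _ : P => K) y) (X j₀)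
          (Lagrange.interpolate P id F)
        rw [Polynomial.coe_aeval_eq_eval] at this
        exact this.symm
      have h2 : X j₀ y = id (y : K) := hj₀ y
      rw [h1, h2, Lagrange.eval_interpolate_at_node F (Function.injective_id.injOn) y.2]
      simp [F]
    rw [hf, Polynomial.aeval_eq_sum_range]
    refine Submodule.sum_mem _ fun n _ => Submodule.smul_mem _ _ ?_
    rw [← monom_single X j₀ n]
    exact hmem _
  have hfin : Module.finrank K (P → K) = P.card := by simp
  rw [← hfin, ← finrank_top, ← htop]
  refine (finrank_span_finset_le_card B).trans (Finset.card_image_le.trans ?_)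
  simp

/-- The product of the first `m` conjugates of `y` under the map `y ↦ y ^ q`. -/
def conjProd {K : Type*} [Field K] (q m : ℕ) (y : K) : K := ∏ j : Fin m, y ^ q ^ (j : ℕ)

section ConjProd

variable {K : Type*} [Field K] {q m : ℕ}

lemma conjProd_ne_zero {y : K} (hy : y ≠ 0) : conjProd q m y ≠ 0 :=
  Finset.prod_ne_zero_iff.2 fun _ _ => pow_ne_zero _ hy

lemma conjProd_div (y z : K) : conjProd q m (y / z) = conjProd q m y / conjProd q m z := by
  simp [conjProd, div_pow, Finset.prod_div_distrib]

lemma conjProd_pow (hK : ∀ y : K, y ^ q ^ m = y) (y : K) :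
    conjProd q m y ^ q = conjProd q m y := by
  rcases eq_or_ne y 0 with rfl | hy
  · rcases Nat.eq_zero_or_pos m with rfl | hm
    · simp [conjProd]
    rcases Nat.eq_zero_or_pos q with rfl | hq
    · have := hK 0
      simp [hm.ne'] at this
    · have h0 : conjProd q m (0 : K) = 0 :=
        Finset.prod_eq_zero (Finset.mem_univ ⟨0, hm⟩) (by simp)
      rw [h0, zero_pow hq.ne']
  · have hR : ∀ n, ∏ j : Fin n, y ^ q ^ (j : ℕ) = ∏ j ∈ Finset.range n, y ^ q ^ j :=
      fun n => Fin.prod_univ_eq_prod_range (fun j => y ^ q ^ j) n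
    rw [conjProd, hR, ← Finset.prod_pow]
    have h1 := Finset.prod_range_succ (fun j => y ^ q ^ j) m
    have h2 := Finset.prod_range_succ' (fun j => y ^ q ^ j) m
    rw [h1, hK] at h2
    simp only [pow_zero, pow_one] at h2
    have h3 := mul_right_cancel₀ hy h2
    rw [h3]
    exact Finset.prod_congr rfl fun j _ => by rw [← pow_mul, ← pow_succ]

end ConjProd

/-- The colouring of `K_n` by the sum of the two labels and the ratio of their conjugate
products, where `enc` encodes such pairs as natural numbers. -/
def normColoring {K : Type*} [Field K] (q m n : ℕ) (enc : K × K → ℕ) (x : Fin n → K)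
    (a b : Fin n) : ℕ :=
  enc (x a + x b, conjProd q m (x (min a b)) / conjProd q m (x (max a b)))

section NormColoring

variable {K : Type*} [Field K] {q m n : ℕ} {enc : K × K → ℕ} {x : Fin n → K}

lemma isProperEdgeColoring_normColoring (henc : Function.Injective enc)
    (hx : Function.Injective x) : IsProperEdgeColoring n (normColoring q m n enc x) := by
  refine ⟨fun a b => ?_, fun a b b' _ _ hbb' h => hbb' ?_⟩
  · rw [normColoring, normColoring, add_comm, min_comm, max_comm]
  · exact hx (add_left_cancel (Prod.ext_iff.1 (henc h)).1)

lemma numColors_normColoring_le [Fintype K] (hq : 2 ≤ q) (hK : ∀ y : K, y ^ q ^ m = y) :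
    numColors n (normColoring q m n enc x) ≤ Fintype.card K * q := by
  classical
  set F : Finset K := Finset.univ.filter fun t => t ^ q = t with hF
  have hFcard : F.card ≤ q := by
    have hdeg : (Polynomial.X ^ q - Polynomial.X : Polynomial K).natDegree = q :=
      FiniteField.X_pow_card_sub_X_natDegree_eq K hq
    have hne : (Polynomial.X ^ q - Polynomial.X : Polynomial K) ≠ 0 :=
      FiniteField.X_pow_card_sub_X_ne_zero K hq
    rw [← hdeg]
    refine Polynomial.card_le_degree_of_subset_roots fun t ht => ?_
    have ht' : t ^ q = t := (Finset.mem_filter.1 ht).2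
    rw [Polynomial.mem_roots hne]
    simp [ht']
  calc numColors n (normColoring q m n enc x)
      ≤ ((Finset.univ ×ˢ F).image enc).card := by
        refine Finset.card_le_card fun k hk => ?_
        obtain ⟨p, _, rfl⟩ := Finset.mem_image.1 hk
        refine Finset.mem_image_of_mem _ (Finset.mem_product.2 ⟨Finset.mem_univ _, ?_⟩)
        rw [hF, Finset.mem_filter, ← conjProd_div]
        exact ⟨Finset.mem_univ _, conjProd_pow hK _⟩
    _ ≤ (Finset.univ ×ˢ F).card := Finset.card_image_le
    _ ≤ Fintype.card K * q := by
        rw [Finset.card_product, Finset.card_univ]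
        exact Nat.mul_le_mul_left _ hFcard

lemma eq_of_connected {V α : Type*} {T : SimpleGraph V} (hT : T.Connected) (f : V → α)
    (h : ∀ u v, T.Adj u v → f u = f v) (u v : V) : f u = f v := by
  obtain ⟨p⟩ := hT.preconnected u v
  induction p with
  | nil => rfl
  | cons hadj _ ih => exact (h _ _ hadj).trans ih

/-- Copies of a connected graph with the same colours and the same orientation of the edges
are determined, up to boundedly many choices, by the image of one vertex. -/
lemma card_copies_le [CharP K 2] (i : ℕ) {V : Type*} [Fintype V] {T : SimpleGraph V}
    (hT : T.Connected) (hV : Fintype.card V = m + 1) (hm : 1 ≤ m)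
    (henc : Function.Injective enc) (hx : Function.Injective x) (hx0 : ∀ a, x a ≠ 0)
    {k : ℕ} (φ : Fin k → V → Fin n) (hinj : ∀ c, Function.Injective (φ c))
    (hdisj : ∀ c d, c ≠ d → ∀ u v, φ c u ≠ φ d v)
    (P : Finset (Fin k))
    (hcol : ∀ c d, ∀ u v, T.Adj u v → normColoring (2 ^ i) m n enc x (φ c u) (φ c v) =
      normColoring (2 ^ i) m n enc x (φ d u) (φ d v))
    (horient : ∀ c ∈ P, ∀ d ∈ P, ∀ u v, φ c u < φ c v ↔ φ d u < φ d v) :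
    P.card ≤ (m * (m + 1)) ^ m := by
  classical
  obtain rfl | ⟨d, hd⟩ := P.eq_empty_or_nonempty
  · simp
  obtain ⟨v₀⟩ := hT.nonempty
  have : ExpChar K 2 := ExpChar.prime Nat.prime_two
  set N : K → K := conjProd (2 ^ i) m with hN
  have hN0 : ∀ a, N (x a) ≠ 0 := fun a => conjProd_ne_zero (hx0 a)
  have hpair : ∀ c u v, T.Adj u v → x (φ c u) + x (φ c v) = x (φ d u) + x (φ d v) :=
    fun c u v huv => (Prod.ext_iff.1 (henc (hcol c d u v huv))).1
  have hsum : ∀ c v, x (φ c v) - x (φ d v) = x (φ c v₀) - x (φ d v₀) := by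
    intro c v
    refine eq_of_connected hT (fun v => x (φ c v) - x (φ d v)) (fun u w huw => ?_) v v₀
    have h := hpair c u w huw
    rw [← CharTwo.sub_eq_add, ← CharTwo.sub_eq_add] at h
    linear_combination h
  have hratio : ∀ c ∈ P, ∀ v, N (x (φ c v)) / N (x (φ d v)) =
      N (x (φ c v₀)) / N (x (φ d v₀)) := by
    intro c hc v
    refine eq_of_connected hT (fun v => N (x (φ c v)) / N (x (φ d v))) ?_ v v₀
    have aux : ∀ u w, T.Adj u w → φ c u < φ c w →
        N (x (φ c u)) / N (x (φ d u)) = N (x (φ c w)) / N (x (φ d w)) := by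
      intro u w huw hlt
      have hlt' := (horient c hc d hd u w).1 hlt
      have h := (Prod.ext_iff.1 (henc (hcol c d u w huw))).2
      simp only [min_eq_left hlt.le, max_eq_right hlt.le, min_eq_left hlt'.le,
        max_eq_right hlt'.le] at h
      rw [← hN, div_eq_div_iff (hN0 _) (hN0 _)] at h
      rw [div_eq_div_iff (hN0 _) (hN0 _)]
      linear_combination h
    intro u w huw
    rcases lt_trichotomy (φ c u) (φ c w) with h | h | h
    · exact aux u w huw h
    · exact absurd (hinj c h) huw.ne
    · exact (aux w u huw.symm h).symm
  set B : V → K := fun v => x (φ d v) - x (φ d v₀) with hB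
  have hBinj : Function.Injective B := fun u v h => hinj d (hx (sub_left_injective h))
  have hB0 : ∀ v : {v // v ≠ v₀}, B v ≠ 0 := fun v h =>
    v.2 (hinj d (hx (sub_eq_zero.1 h)))
  set Q : Finset K := P.image fun c => (x (φ c v₀))⁻¹ with hQ
  have hPQ : P.card = Q.card := by
    refine (Finset.card_image_of_injective _ fun c c' h => ?_).symm
    by_contra hne
    exact hdisj c c' hne v₀ v₀ (hx (inv_injective h))
  have hbound := card_le_of_prod_sub_eq (ι := {v // v ≠ v₀}) (κ := Fin m)
    (by rw [Fintype.card_subtype_compl, Fintype.card_subtype_eq, hV, Fintype.card_fin]; omega)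
    Q (fun j y => y ^ (2 ^ i) ^ (j : ℕ)) ⟨0, hm⟩ (fun y => by simp)
    (fun v j => (-(B v)⁻¹) ^ (2 ^ i) ^ (j : ℕ)) ?_
    (fun v => N (x (φ d v)) / N (x (φ d v₀)) / N (B v)) ?_
  · rwa [hPQ, ← Fintype.card_fin m]
  · intro j u v h
    simp only [← pow_mul] at h
    have := iterateFrobenius_inj K 2 (i * j) (by
      simpa only [iterateFrobenius_def, pow_mul] using h)
    exact Subtype.ext (hBinj (inv_injective (neg_injective this)))
  · intro y hy v
    obtain ⟨c, hc, rfl⟩ := Finset.mem_image.1 hy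
    have hfrob : ∀ (j : Fin m), ((x (φ c v₀))⁻¹) ^ (2 ^ i) ^ (j : ℕ) -
        (-(B v)⁻¹) ^ (2 ^ i) ^ (j : ℕ) =
        (x (φ c v) / x (φ c v₀) / B v) ^ (2 ^ i) ^ (j : ℕ) := by
      intro j
      rw [← pow_mul, ← sub_pow_expChar_pow]
      congr 1
      have h1 := hsum c v
      have h2 := hB0 v
      have h3 := hx0 (φ c v₀)
      have h4 : x (φ c v) = x (φ c v₀) + B v := by
        rw [hB]
        linear_combination h1
      rw [h4]
      field_simp
      ring
    rw [Finset.prod_congr rfl fun j _ => hfrob j]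
    change N _ = _
    rw [hN, conjProd_div, conjProd_div, ← hN]
    congr 1
    have := hratio c hc v
    rw [div_eq_div_iff (hN0 _) (hN0 _)] at this ⊢
    linear_combination this

lemma not_hasRepeat_normColoring [CharP K 2] (i : ℕ) {V : Type*} [Fintype V] [DecidableEq V]
    {T : SimpleGraph V} (hT : T.Connected) (hV : Fintype.card V = m + 1) (hm : 1 ≤ m)
    (henc : Function.Injective enc) (hx : Function.Injective x) (hx0 : ∀ a, x a ≠ 0)
    {k : ℕ} (hk : Fintype.card (V → V → Bool) * (m * (m + 1)) ^ m < k) :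
    ¬ HasRepeat n k T (normColoring (2 ^ i) m n enc x) := by
  rintro ⟨φ, hinj, hdisj, hcol⟩
  obtain ⟨o, ho⟩ := Fintype.exists_lt_card_fiber_of_mul_lt_card
    (fun c : Fin k => fun u v : V => decide (φ c u < φ c v)) (by simpa using hk)
  refine absurd (card_copies_le i hT hV hm henc hx hx0 φ hinj hdisj _ hcol ?_) (not_le.2 ho)
  intro c hc d hd u v
  have h := (Finset.mem_filter.1 hc).2.trans (Finset.mem_filter.1 hd).2.symm
  simpa using congrFun (congrFun h u) v

end NormColoring

/-- The norm colouring over the field with `2 ^ (i * m)` elements bounds the repeat number. -/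
theorem repeatNumber_le {V : Type*} [Fintype V] [DecidableEq V] {T : SimpleGraph V}
    (hT : T.Connected) {m : ℕ} (hV : Fintype.card V = m + 1) (hm : 1 ≤ m) {k : ℕ}
    (hk : Fintype.card (V → V → Bool) * (m * (m + 1)) ^ m < k) {n i : ℕ} (hi : i ≠ 0)
    (hn : n < 2 ^ (i * m)) : repeatNumber k n T ≤ (2 ^ i) ^ (m + 1) := by
  classical
  let K := GaloisField 2 (i * m)
  have him : i * m ≠ 0 := Nat.mul_ne_zero hi (by omega)
  let _ : Fintype K := Fintype.ofFinite K
  have hcard : Fintype.card K = 2 ^ (i * m) := by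
    rw [← Nat.card_eq_fintype_card]
    exact GaloisField.card 2 (i * m) him
  obtain ⟨x⟩ : Nonempty (Fin n ↪ {y : K // y ≠ 0}) := by
    refine Function.Embedding.nonempty_of_card_le ?_
    rw [Fintype.card_fin, Fintype.card_subtype_compl, Fintype.card_subtype_eq, hcard]
    omega
  let enc : K × K → ℕ := fun p => Fintype.equivFin (K × K) p
  have henc : Function.Injective enc :=
    Fin.val_injective.comp (Fintype.equivFin (K × K)).injective
  let x' : Fin n → K := fun a => x a
  have hx : Function.Injective x' := Subtype.val_injective.comp x.injective
  have hfrob : ∀ y : K, y ^ (2 ^ i) ^ m = y := fun y => by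
    rw [← pow_mul, ← hcard, FiniteField.pow_card]
  have hle : repeatNumber k n T ≤ numColors n (normColoring (2 ^ i) m n enc x') :=
    Nat.sInf_le ⟨_, isProperEdgeColoring_normColoring henc hx, rfl,
      not_hasRepeat_normColoring i hT hV hm henc hx (fun a => (x a).2) hk⟩
  refine hle.trans ((numColors_normColoring_le (Nat.le_self_pow hi 2) hfrob).trans_eq ?_)
  rw [hcard, pow_mul, pow_succ]

/-- For any tree `T` with `m ≥ 1` edges, there exists `k'` with
`f_{k'}(n,T) = O(n^{(m+1)/m})`. -/
theorem stmt_9 (V : Type) [Fintype V] [DecidableEq V] (T : SimpleGraph V)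
    [DecidableRel T.Adj] (hT : T.IsTree) (m : ℕ) (hm : 1 ≤ m)
    (hme : T.edgeFinset.card = m) :
    ∃ k' : ℕ, 2 ≤ k' ∧ ∃ c : ℝ, 0 < c ∧ ∃ n₀ : ℕ, ∀ n ≥ n₀,
      (repeatNumber k' n T : ℝ) ≤ c * (n : ℝ) ^ (((m : ℝ) + 1) / (m : ℝ)) := by
  have hV : Fintype.card V = m + 1 := by
    rw [← hT.card_edgeFinset, hme]
  set k := Fintype.card (V → V → Bool) * (m * (m + 1)) ^ m + 2 with hk
  refine ⟨k, by omega, 2 ^ (m + 1), by positivity, 1, fun n hn => ?_⟩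
  have hb : 1 < 2 ^ m := Nat.one_lt_two_pow (by omega)
  set l := Nat.log (2 ^ m) n with hl
  have hlt : n < 2 ^ ((l + 1) * m) := by
    rw [mul_comm, pow_mul]
    exact Nat.lt_pow_succ_log_self hb n
  have hle : (2 ^ l) ^ m ≤ n := by
    rw [← pow_mul, mul_comm, pow_mul]
    exact Nat.pow_log_le_self _ (by omega)
  have hbound : repeatNumber k n T ≤ (2 ^ (l + 1)) ^ (m + 1) :=
    repeatNumber_le hT.connected hV hm (by omega) (Nat.succ_ne_zero l) hlt
  have hm0 : (m : ℝ) ≠ 0 := by positivity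
  have hroot : ((2 : ℝ) ^ l) ^ (m + 1) ≤ (n : ℝ) ^ (((m : ℝ) + 1) / (m : ℝ)) := by
    have h1 : (((2 : ℝ) ^ l) ^ m) ^ (((m : ℝ) + 1) / (m : ℝ)) = ((2 : ℝ) ^ l) ^ (m + 1) := by
      rw [← Real.rpow_natCast ((2 : ℝ) ^ l) m, ← Real.rpow_mul (by positivity),
        mul_div_cancel₀ _ hm0, ← Real.rpow_natCast _ (m + 1),
        Nat.cast_add_one]
    rw [← h1]
    exact Real.rpow_le_rpow (by positivity) (by exact_mod_cast hle) (by positivity)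
  calc (repeatNumber k n T : ℝ) ≤ (2 ^ (l + 1)) ^ (m + 1) := by exact_mod_cast hbound
    _ = 2 ^ (m + 1) * (2 ^ l) ^ (m + 1) := by rw [pow_succ 2 l, mul_pow, mul_comm]
    _ ≤ _ := by gcongr
end

section
/- Let H be a graph and b, k, n ≥ 2 integers. Any (not necessarily proper) edge-colouring of K_n with C colours in which every colour class is a graph of maximum degree at most b, and which contains no k pairwise vertex-disjoint, pairwise colour-isomorphic copies of H under any (not necessarily proper) colouring of H, can be refined to a proper edge-colouring of K_n with at most (b+1)·C colours containing no k pairwise vertex-disjoint, pairwise colour-isomorphic copies of H. -/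
open Finset

/-- A proper partial edge colouring: `f u v = none` means that `uv` is not coloured. -/
structure IsPartialEdgeColoring {V κ : Type*} (f : V → V → Option κ) : Prop where
  symm : ∀ u v, f u v = f v u
  irrefl : ∀ u, f u u = none
  inj : ∀ {u v w γ}, f u v = some γ → f u w = some γ → v = w

/-- No edge at `u` has colour `γ`. -/
def MissesColor {V κ : Type*} (f : V → V → Option κ) (u : V) (γ : κ) : Prop :=
  ∀ v, f u v ≠ some γ

/-- A Vizing fan at `x` starting from `y`, listed with the most recent vertex first: the colour
of the edge from `x` to each later vertex is missing at the vertex just before it. -/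
inductive IsFan {V κ : Type*} (f : V → V → Option κ) (x y : V) : List V → Prop
  | base : IsFan f x y [y]
  | cons {z w : V} {l : List V} {γ : κ} : IsFan f x y (w :: l) → z ∉ w :: l →
      f x z = some γ → MissesColor f w γ → IsFan f x y (z :: w :: l)

/-- The subgraph formed by the edges of colour `α` or `β`. -/
def kempeGraph {V κ : Type*} {f : V → V → Option κ} (hf : IsPartialEdgeColoring f) (α β : κ) :
    SimpleGraph V where
  Adj u v := f u v = some α ∨ f u v = some β
  symm := ⟨fun u v h => by rwa [hf.symm v u]⟩
  loopless := ⟨fun u h => by simp [hf.irrefl] at h⟩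

open Classical in
/-- Exchange the colours `α` and `β` on their two-coloured component containing `a`. -/
noncomputable def kempeSwap {V κ : Type*} {f : V → V → Option κ} (hf : IsPartialEdgeColoring f)
    (α β : κ) (a u v : V) : Option κ :=
  if (kempeGraph hf α β).Reachable a u then (f u v).map (Equiv.swap α β) else f u v

namespace IsPartialEdgeColoring

variable {V κ : Type*} {f : V → V → Option κ} {x y : V} {α β : κ}

theorem kempeSwap_of_not_reachable (hf : IsPartialEdgeColoring f) {a u : V}
    (h : ¬ (kempeGraph hf α β).Reachable a u) (v : V) : kempeSwap hf α β a u v = f u v := by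
  simp [kempeSwap, h]

theorem missesColor_kempeSwap (hf : IsPartialEdgeColoring f) {a u : V}
    (h : (kempeGraph hf α β).Reachable a u) (hβ : MissesColor f u β) :
    MissesColor (kempeSwap hf α β a) u α := by
  classical
  intro v hv
  simp only [kempeSwap, h, if_true, Option.map_eq_some_iff] at hv
  obtain ⟨δ, hδ, hs⟩ := hv
  rw [Equiv.swap_apply_eq_iff, Equiv.swap_apply_left] at hs
  exact hβ v (hs ▸ hδ)

theorem missesColor_kempeSwap_of_ne (hf : IsPartialEdgeColoring f) {a u : V} {γ : κ}
    (hα : γ ≠ α) (hβ : γ ≠ β) (h : MissesColor f u γ) :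
    MissesColor (kempeSwap hf α β a) u γ := by
  classical
  intro v hv
  unfold kempeSwap at hv
  split_ifs at hv with hr
  · obtain ⟨δ, hδ, hs⟩ := Option.map_eq_some_iff.1 hv
    rw [Equiv.swap_apply_eq_iff, Equiv.swap_apply_of_ne_of_ne hα hβ] at hs
    exact h v (hs ▸ hδ)
  · exact h v hv

theorem kempeSwap_eq_none_iff (hf : IsPartialEdgeColoring f) (a u v : V) :
    kempeSwap hf α β a u v = none ↔ f u v = none := by
  unfold kempeSwap
  split_ifs <;> simp

theorem isPartialEdgeColoring_kempeSwap (hf : IsPartialEdgeColoring f) (α β : κ) (a : V) :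
    IsPartialEdgeColoring (kempeSwap hf α β a) where
  symm u v := by
    classical
    by_cases hadj : (kempeGraph hf α β).Adj u v
    · have : (kempeGraph hf α β).Reachable a u ↔ (kempeGraph hf α β).Reachable a v :=
        ⟨fun h => h.trans hadj.reachable, fun h => h.trans hadj.symm.reachable⟩
      simp only [kempeSwap, this, hf.symm u v]
    · have hfix : ∀ o : Option κ, o = f u v → o.map (Equiv.swap α β) = o := by
        rintro (_ | γ) ho
        · rfl
        · have hne : γ ≠ α ∧ γ ≠ β := by
            constructor <;> rintro rfl <;> exact hadj (by simp [kempeGraph, ← ho])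
          simp [Equiv.swap_apply_of_ne_of_ne hne.1 hne.2]
      simp only [kempeSwap, hfix _ (hf.symm v u), ite_self, hf.symm u v]
  irrefl u := (hf.kempeSwap_eq_none_iff a u u).2 (hf.irrefl u)
  inj := by
    classical
    intro u v w γ hv hw
    unfold kempeSwap at hv hw
    split_ifs at hv hw with hr
    · obtain ⟨δ, hδ, hs⟩ := Option.map_eq_some_iff.1 hv
      obtain ⟨ε, hε, ht⟩ := Option.map_eq_some_iff.1 hw
      have : δ = ε := (Equiv.swap α β).injective (hs.trans ht.symm)
      exact hf.inj hδ (this ▸ hε)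
    · exact hf.inj hv hw

/-- A two-coloured component is a path or a cycle, so at most two of its vertices miss one of the
two colours. -/
theorem not_reachable_of_misses [Finite V] (hf : IsPartialEdgeColoring f) {u v w : V}
    (huv : u ≠ v) (huw : u ≠ w) (hvw : v ≠ w)
    (hu : MissesColor f u α ∨ MissesColor f u β) (hv : MissesColor f v α ∨ MissesColor f v β)
    (hw : MissesColor f w α ∨ MissesColor f w β)
    (h : (kempeGraph hf α β).Reachable u v) : ¬ (kempeGraph hf α β).Reachable u w := by
  classical
  intro h'
  have := Fintype.ofFinite V
  set K := (kempeGraph hf α β).connectedComponentMk u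
  have hc : K.toSimpleGraph.Connected := K.connected_toSimpleGraph
  have hmem : ∀ {a}, (kempeGraph hf α β).Reachable u a → a ∈ K.supp := fun ha =>
    SimpleGraph.ConnectedComponent.sound ha.symm
  let T : Finset K := {⟨u, hmem .rfl⟩, ⟨v, hmem h⟩, ⟨w, hmem h'⟩}
  have hT : T.card = 3 := Finset.card_eq_three.2
    ⟨_, _, _, by simpa using huv, by simpa using huw, by simpa using hvw, rfl⟩
  have hmiss : ∀ a ∈ T, MissesColor f a α ∨ MissesColor f a β := by
    simp [T, hu, hv, hw]
  have hadj : ∀ a d : K, K.toSimpleGraph.Adj a d → f a d = some α ∨ f a d = some β :=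
    fun a d h => h
  have hdeg : ∀ (a : K) (S : Finset (Option κ)), none ∉ S →
      (∀ d, K.toSimpleGraph.Adj a d → f a d ∈ S) → K.toSimpleGraph.degree a ≤ S.card := by
    intro a S hS hmap
    refine Finset.card_le_card_of_injOn (fun d : K => f a d) (fun d hd => ?_) ?_
    · exact hmap d (by simpa using hd)
    · intro d hd e he hde
      rcases hadj a d (by simpa using hd) with h1 | h1 <;>
        exact Subtype.ext (hf.inj h1 (hde.symm.trans h1))
  have hle : ∀ a : K, K.toSimpleGraph.degree a + (if a ∈ T then 1 else 0) ≤ 2 := by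
    intro a
    split_ifs with ha
    · rcases hmiss a ha with hm | hm
      · have := hdeg a {some β} (by simp) fun d hd => by
          simpa [hm (d : V)] using hadj a d hd
        simpa using this
      · have := hdeg a {some α} (by simp) fun d hd => by
          simpa [hm (d : V)] using hadj a d hd
        simpa using this
    · have := hdeg a {some α, some β} (by simp) fun d hd => by simpa using hadj a d hd
      exact this.trans Finset.card_le_two
  have hsum := Finset.sum_le_sum fun a (_ : a ∈ Finset.univ) => hle a
  have hedges := hc.card_vert_le_card_edgeSet_add_one
  rw [Finset.sum_add_distrib, SimpleGraph.sum_degrees_eq_twice_card_edges,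
    Finset.sum_ite_mem, Finset.univ_inter, Finset.sum_const, Finset.sum_const, hT] at hsum
  rw [Nat.card_eq_fintype_card, Nat.card_eq_fintype_card, ← SimpleGraph.edgeFinset_card]
    at hedges
  simp only [Finset.card_univ, smul_eq_mul] at hsum
  omega

end IsPartialEdgeColoring

namespace IsFan

variable {V κ : Type*} {f g : V → V → Option κ} {x y : V} {α β : κ} {L : List V}

theorem mono (h : IsFan f x y L) (hcol : ∀ z ∈ L, g x z = f x z)
    (hmiss : ∀ w ∈ L.tail, ∀ z ∈ L, ∀ γ, f x z = some γ → MissesColor f w γ →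
      MissesColor g w γ) : IsFan g x y L := by
  induction h with
  | base => exact .base
  | @cons z w l γ h hz hγ hw ih =>
    refine .cons (ih (fun u hu => hcol u (.tail _ hu)) fun u hu v hv => ?_) hz
      ((hcol z (by simp)).trans hγ) (hmiss w (by simp) z (by simp) γ hγ hw)
    exact hmiss u (.tail _ hu) v (.tail _ hv)

theorem notMem_center (h : IsFan f x y L) (hf : IsPartialEdgeColoring f) (hxy : x ≠ y) :
    x ∉ L := by
  induction h with
  | base => simpa using hxy
  | @cons z w l γ h hz hγ hw ih =>
    rw [List.mem_cons, not_or]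
    refine ⟨?_, ih⟩
    rintro rfl
    simp [hf.irrefl] at hγ

theorem nodup (h : IsFan f x y L) : L.Nodup := by
  induction h with
  | base => simp
  | cons h hz _ _ ih => exact List.nodup_cons.2 ⟨hz, ih⟩

theorem exists_suffix (h : IsFan f x y L) {w : V} (hw : w ∈ L) :
    ∃ l, IsFan f x y (w :: l) ∧ w :: l ⊆ L := by
  induction h with
  | base =>
    obtain rfl := List.mem_singleton.1 hw
    exact ⟨[], .base, List.Subset.refl _⟩
  | @cons z u l γ h hz hγ hu ih =>
    rcases List.mem_cons.1 hw with rfl | hw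
    · exact ⟨_, .cons h hz hγ hu, List.Subset.refl _⟩
    · obtain ⟨l', h', hs⟩ := ih hw
      exact ⟨l', h', List.subset_cons_of_subset _ hs⟩

theorem exists_missesColor_of_mem (h : IsFan f x y L) (hy : f x y = none) {v : V} (hv : v ∈ L)
    (hβ : f x v = some β) : ∃ w ∈ L.tail, MissesColor f w β := by
  induction h with
  | base => simp_all
  | @cons z w l γ h hz hγ hw ih =>
    rcases List.mem_cons.1 hv with rfl | hv
    · obtain rfl : γ = β := Option.some.inj (hγ.symm.trans hβ)
      exact ⟨w, by simp, hw⟩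
    · obtain ⟨u, hu, hm⟩ := ih hv
      exact ⟨u, List.mem_of_mem_tail hu, hm⟩

end IsFan

namespace IsPartialEdgeColoring

variable {V κ : Type*} {f : V → V → Option κ} {x y : V} {α β : κ}

open Classical in
/-- Recolour the edge `xz` with a colour missing at both of its ends. -/
theorem recolor (hf : IsPartialEdgeColoring f) {z : V} (hxz : x ≠ z)
    (hx : MissesColor f x α) (hz : MissesColor f z α) :
    IsPartialEdgeColoring fun u v => if s(u, v) = s(x, z) then some α else f u v where
  symm u v := by simp only [Sym2.eq_swap (a := u), hf.symm u v]
  irrefl u := by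
    rw [if_neg, hf.irrefl]
    rintro h
    rw [Sym2.eq_iff] at h
    grind
  inj {u v w γ} hv hw := by
    have := @hf.inj u v w γ
    simp only [Sym2.eq_iff, MissesColor] at hv hw hx hz
    grind

/-- `f` can be recoloured so that exactly the edge `xy` is coloured in addition. -/
def Extendable (f : V → V → Option κ) (x y : V) : Prop :=
  ∃ g : V → V → Option κ, IsPartialEdgeColoring g ∧
    ∀ u v, g u v = none ↔ f u v = none ∧ s(u, v) ≠ s(x, y)

theorem Extendable.congr {g : V → V → Option κ} (h : Extendable g x y)
    (hg : ∀ u v, g u v = none ↔ f u v = none) : Extendable f x y := by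
  obtain ⟨g', hg', hs⟩ := h
  exact ⟨g', hg', fun u v => by rw [hs, hg]⟩

theorem extendable_of_isFan (hxy : x ≠ y) {l : List V} :
    ∀ {f : V → V → Option κ} {z : V} {α : κ}, IsPartialEdgeColoring f → IsFan f x y (z :: l) →
      MissesColor f x α → MissesColor f z α → Extendable f x y := by
  classical
  induction l with
  | nil =>
    intro f z α hf h hx hz
    cases h
    refine ⟨_, hf.recolor hxy hx hz, fun u v => ?_⟩
    split_ifs with h <;> simp [h]
  | cons w l ih =>
    intro f z α hf h hx hz
    have hxL := h.notMem_center hf hxy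
    cases h with
    | @cons _ _ _ γ h hzl hγ hw =>
    have hxz : x ≠ z := fun e => hxL (by simp [e])
    have hαγ : γ ≠ α := fun e => hx z (e ▸ hγ)
    have hmiss : ∀ u ∈ w :: l, ∀ δ, MissesColor f u δ →
        MissesColor (fun u v => if s(u, v) = s(x, z) then some α else f u v) u δ := by
      intro u hu δ hδ v
      have h1 : u ≠ z := fun e => hzl (e ▸ hu)
      have h2 : u ≠ x := fun e => hxL (e ▸ .tail _ hu)
      simpa [h1, h2] using hδ v
    refine (ih (α := γ) (hf.recolor hxz hx hz)
      (h.mono (fun u hu => ?_) fun u hu v _ δ _ hδ => hmiss u (List.mem_of_mem_tail hu) δ hδ) ?_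
      (hmiss w (by simp) γ hw)).congr fun u v => ?_
    · have h1 : u ≠ z := fun e => hzl (e ▸ hu)
      simp [h1, hxz]
    · intro v
      have := @hf.inj x v z γ
      simp only [Sym2.eq_iff]
      grind
    · have := hf.symm
      split_ifs with h
      · rcases Sym2.eq_iff.1 h with ⟨rfl, rfl⟩ | ⟨rfl, rfl⟩
        · simp [hγ]
        · simp [hf.symm u v, hγ]
      · rfl

/-- If `x` is outside the two-coloured component of the head `z` of a fan, and so is every other
fan vertex missing `β`, then exchanging colours on that component allows `xy` to be coloured. -/
theorem extendable_of_kempeSwap (hf : IsPartialEdgeColoring f) (hxy : x ≠ y) {z : V} {l : List V}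
    (h : IsFan f x y (z :: l)) (hx : MissesColor f x α) (hz : MissesColor f z β)
    (hzx : ¬ (kempeGraph hf α β).Reachable z x)
    (hl : ∀ w ∈ l, MissesColor f w β → ¬ (kempeGraph hf α β).Reachable z w) :
    Extendable f x y := by
  refine (extendable_of_isFan (α := α) hxy (hf.isPartialEdgeColoring_kempeSwap α β z)
    (h.mono (fun v _ => hf.kempeSwap_of_not_reachable hzx v) ?_) ?_
    (hf.missesColor_kempeSwap .rfl hz)).congr (hf.kempeSwap_eq_none_iff z)
  · intro w hw v _ γ hγ hm
    have hα : γ ≠ α := fun e => hx v (e ▸ hγ)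
    by_cases hβ : γ = β
    · subst hβ
      intro u
      rw [hf.kempeSwap_of_not_reachable (hl w hw hm)]
      exact hm u
    · exact hf.missesColor_kempeSwap_of_ne hα hβ hm
  · intro v
    rw [hf.kempeSwap_of_not_reachable hzx]
    exact hx v

theorem extendable_of_two_misses [Finite V] (hf : IsPartialEdgeColoring f) (hxy : x ≠ y)
    (hx : MissesColor f x α) {L : List V} (h : IsFan f x y L) {a d : V} (ha : a ∈ L) (hd : d ∈ L)
    (had : a ≠ d) (hma : MissesColor f a β) (hmd : MissesColor f d β) : Extendable f x y := by
  induction h generalizing a d with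
  | base => simp_all
  | @cons z w l γ h hz hγ hw ih =>
    by_cases htwo : ∃ a ∈ w :: l, ∃ d ∈ w :: l, a ≠ d ∧ MissesColor f a β ∧ MissesColor f d β
    · obtain ⟨a, ha, d, hd, had, hma, hmd⟩ := htwo
      exact ih ha hd had hma hmd
    have huniq : ∀ a ∈ w :: l, MissesColor f a β → ∀ d ∈ w :: l, MissesColor f d β → a = d := by
      intro a ha hma d hd hmd
      by_contra had
      exact htwo ⟨a, ha, d, hd, had, hma, hmd⟩
    obtain ⟨u, hu, hmu, hmz⟩ : ∃ u ∈ w :: l, MissesColor f u β ∧ MissesColor f z β := by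
      rcases List.mem_cons.1 ha with rfl | ha'
      · exact ⟨d, (List.mem_cons.1 hd).resolve_left had.symm, hmd, hma⟩
      · rcases List.mem_cons.1 hd with rfl | hd
        · exact ⟨a, ha', hma, hmd⟩
        · exact absurd (huniq a ha' hma d hd hmd) had
    have hfan := IsFan.cons h hz hγ hw
    have hxL := hfan.notMem_center hf hxy
    have hux : u ≠ x := fun e => hxL (e ▸ .tail _ hu)
    have hzx : z ≠ x := fun e => hxL (by simp [e])
    have huz : u ≠ z := fun e => hz (e ▸ hu)
    by_cases hr : (kempeGraph hf α β).Reachable u x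
    · have hnot := hf.not_reachable_of_misses hux huz hzx.symm (.inr hmu) (.inl hx) (.inr hmz) hr
      refine hf.extendable_of_kempeSwap hxy hfan hx hmz (fun h' => hnot (hr.trans h'.symm)) ?_
      intro d hd hmd
      obtain rfl := huniq u hu hmu d hd hmd
      exact fun h' => hnot h'.symm
    · obtain ⟨l', hl', hsub⟩ := h.exists_suffix hu
      refine hf.extendable_of_kempeSwap hxy hl' hx hmu hr fun d hd hmd => ?_
      obtain rfl := huniq u hu hmu d (hsub (.tail _ hd)) hmd
      exact absurd hd (List.nodup_cons.1 hl'.nodup).1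

theorem extendable_of_forall_misses [Fintype V] (hf : IsPartialEdgeColoring f) (hxy : x ≠ y)
    (hy : f x y = none) (hmiss : ∀ u, ∃ γ, MissesColor f u γ) : Extendable f x y := by
  obtain ⟨α, hα⟩ := hmiss x
  suffices H : ∀ (m : ℕ) (z : V) (l : List V), IsFan f x y (z :: l) →
      Fintype.card V ≤ m + (z :: l).length → Extendable f x y from
    H (Fintype.card V) y [] .base (by simp)
  intro m
  induction m with
  | zero =>
    intro z l h hm
    have hlt := (List.nodup_cons.2 ⟨h.notMem_center hf hxy, h.nodup⟩).length_le_card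
    simp only [List.length_cons] at hlt hm
    omega
  | succ m ih =>
    intro z l h hm
    obtain ⟨β, hβ⟩ := hmiss z
    by_cases hx : MissesColor f x β
    · exact extendable_of_isFan hxy hf h hx hβ
    obtain ⟨v, hv⟩ : ∃ v, f x v = some β := by simpa [MissesColor] using hx
    by_cases hvl : v ∈ z :: l
    · obtain ⟨w, hw, hmw⟩ := h.exists_missesColor_of_mem hy hvl hv
      refine hf.extendable_of_two_misses hxy hα h (a := z) (d := w) (by simp) (.tail _ hw) ?_
        hβ hmw
      rintro rfl
      exact (List.nodup_cons.1 h.nodup).1 hw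
    · refine ih v _ (.cons h hvl hv hβ) ?_
      simp only [List.length_cons] at hm ⊢
      omega

end IsPartialEdgeColoring

/-- **Vizing's theorem**: a finite graph of maximum degree at most `b` has a proper edge colouring
with `b + 1` colours. -/
theorem SimpleGraph.exists_edgeColoring_of_degree_le {V : Type*} [Fintype V] (G : SimpleGraph V)
    [DecidableRel G.Adj] {b : ℕ} (hG : ∀ v, G.degree v ≤ b) :
    ∃ f : V → V → Fin (b + 1), (∀ u v, f u v = f v u) ∧
      ∀ u v w, G.Adj u v → G.Adj u w → f u v = f u w → v = w := by
  classical
  suffices H : ∀ S : Finset (Sym2 V), S ⊆ G.edgeFinset → ∃ f : V → V → Option (Fin (b + 1)),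
      IsPartialEdgeColoring f ∧ ∀ u v, f u v = none ↔ s(u, v) ∉ S by
    obtain ⟨f, hf, hs⟩ := H _ subset_rfl
    have hsome : ∀ {u v}, G.Adj u v → f u v = some ((f u v).getD 0) := by
      intro u v h
      have : f u v ≠ none := by simpa [hs] using h
      cases hfu : f u v <;> simp_all
    refine ⟨fun u v => (f u v).getD 0, fun u v => congrArg (Option.getD · 0) (hf.symm u v), fun u v w huv huw h => ?_⟩
    exact hf.inj (hsome huv) ((hsome huw).trans (congrArg some h.symm))
  intro S
  induction S using Finset.induction_on with
  | empty =>
    exact fun _ => ⟨fun _ _ => none, ⟨fun _ _ => rfl, fun _ => rfl, by simp⟩, by simp⟩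
  | insert e S he ih =>
    intro hS
    obtain ⟨f, hf, hs⟩ := ih ((Finset.subset_insert _ _).trans hS)
    induction e using Sym2.ind with
    | _ x y =>
    have hxy : G.Adj x y := by simpa using hS (Finset.mem_insert_self _ _)
    have hmiss : ∀ u, ∃ γ, MissesColor f u γ := by
      intro u
      by_contra! hall
      simp only [MissesColor, not_forall, not_not] at hall
      choose v hv using hall
      have hle : (Finset.univ : Finset (Fin (b + 1))).card ≤ (G.neighborFinset u).card := by
        refine Finset.card_le_card_of_injOn v (fun γ _ => ?_) fun γ _ δ _ h => ?_
        · have : s(u, v γ) ∈ S := by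
            by_contra hn
            have := hv γ
            simp [(hs u (v γ)).2 hn] at this
          simpa using hS (Finset.mem_insert_of_mem this)
        · exact Option.some.inj ((hv γ).symm.trans (h ▸ hv δ))
      rw [Finset.card_univ, Fintype.card_fin, SimpleGraph.card_neighborFinset_eq_degree] at hle
      exact absurd (hG u) (by omega)
    obtain ⟨g, hg, hgs⟩ := hf.extendable_of_forall_misses hxy.ne ((hs x y).2 he) hmiss
    exact ⟨g, hg, fun u v => by rw [hgs, hs, Finset.mem_insert, not_or, and_comm]⟩

/-- Any `b`-bounded (not necessarily proper) edge colouring of `K_n` with `C` colours and no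
`k` disjoint colour-isomorphic copies of `H` can be refined to a proper edge colouring with
at most `(b+1)·C` colours and no `k` disjoint colour-isomorphic copies of `H`. -/
theorem stmt_12 (V : Type) [Fintype V] (H : SimpleGraph V) (b k n C : ℕ)
    (hb : 2 ≤ b) (hk : 2 ≤ k) (hn : 2 ≤ n)
    (c : Fin n → Fin n → ℕ) (hsymm : ∀ a b', c a b' = c b' a)
    (hC : numColors n c = C)
    (hbdd : ∀ v : Fin n, ∀ x : ℕ,
      (Finset.univ.filter fun u : Fin n => u ≠ v ∧ c v u = x).card ≤ b)
    (hno : ¬ HasRepeat n k H c) :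
    ∃ c' : Fin n → Fin n → ℕ, IsProperEdgeColoring n c' ∧
      numColors n c' ≤ (b + 1) * C ∧
      (∀ a₁ b₁ a₂ b₂ : Fin n, a₁ ≠ b₁ → a₂ ≠ b₂ →
        c' a₁ b₁ = c' a₂ b₂ → c a₁ b₁ = c a₂ b₂) ∧
      ¬ HasRepeat n k H c' := by
  classical
  let G : ℕ → SimpleGraph (Fin n) := fun x =>
    { Adj := fun u v => v ≠ u ∧ c u v = x
      symm := ⟨fun u v h => ⟨h.1.symm, by rw [hsymm v u, h.2]⟩⟩
      loopless := ⟨fun u h => h.1 rfl⟩ }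
  have hdeg : ∀ x v, (G x).degree v ≤ b := by
    intro x v
    convert hbdd v x using 1
    rw [← SimpleGraph.card_neighborFinset_eq_degree]
    congr 1
    ext u
    simp [G]
  choose f hfsymm hfinj using fun x => (G x).exists_edgeColoring_of_degree_le (hdeg x)
  let c' : Fin n → Fin n → ℕ := fun u v => Nat.pair (c u v) (f (c u v) u v)
  have href : ∀ a₁ b₁ a₂ b₂ : Fin n, c' a₁ b₁ = c' a₂ b₂ → c a₁ b₁ = c a₂ b₂ :=
    fun a₁ b₁ a₂ b₂ h => (Nat.pair_eq_pair.1 h).1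
  refine ⟨c', ⟨fun u v => ?_, fun u v w huv huw hvw h => hvw ?_⟩, ?_,
    fun a₁ b₁ a₂ b₂ _ _ => href a₁ b₁ a₂ b₂, ?_⟩
  · simp only [c', hsymm v u, hfsymm (c u v) u v]
  · obtain ⟨h₁, h₂⟩ := Nat.pair_eq_pair.1 h
    rw [← h₁] at h₂
    exact hfinj (c u v) u v w ⟨huv.symm, rfl⟩ ⟨huw.symm, h₁.symm⟩ (Fin.ext h₂)
  · rw [← hC, mul_comm]
    unfold numColors
    rw [← Finset.card_range (b + 1), ← Finset.card_product]
    refine (Finset.card_le_card ?_).trans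
      (Finset.card_image_le (f := fun p : ℕ × ℕ => Nat.pair p.1 p.2))
    intro m hm
    obtain ⟨p, hp, rfl⟩ := Finset.mem_image.1 hm
    refine Finset.mem_image.2 ⟨(c p.1 p.2, f (c p.1 p.2) p.1 p.2), ?_, rfl⟩
    exact Finset.mem_product.2
      ⟨Finset.mem_image_of_mem _ hp, Finset.mem_range.2 (Fin.is_lt _)⟩
  · rintro ⟨φ, hinj, hdisj, hcol⟩
    exact hno ⟨φ, hinj, hdisj, fun i j u v h => href _ _ _ _ (hcol i j u v h)⟩
end

section
/- For any graph H with v vertices and e ≥ 1 edges and any k ≥ 2, there exist a constant c > 0 and n₀ such that for all n ≥ n₀, f_k(n,H) ≤ c·max{ n, n^{(kv−2)/((k−1)e)} }. -/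
open Finset

section Counting

variable {ι α J : Type*} [Fintype ι] [DecidableEq ι] [Fintype α] [Fintype J]

open Classical in
/-- The assignments violating none of the bad events supported inside `S`. -/
noncomputable def avoiding (supp : J → Finset ι) (B : J → (ι → α) → Prop) (S : Finset ι) :
    Finset (ι → α) :=
  Finset.univ.filter fun g => ∀ j, supp j ⊆ S → ¬ B j g

lemma mem_avoiding {supp : J → Finset ι} {B : J → (ι → α) → Prop} {S : Finset ι} {g : ι → α} :
    g ∈ avoiding supp B S ↔ ∀ j, supp j ⊆ S → ¬ B j g := by
  simp [avoiding]

lemma avoiding_anti {supp : J → Finset ι} {B : J → (ι → α) → Prop} {S T : Finset ι}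
    (h : T ⊆ S) : avoiding supp B S ⊆ avoiding supp B T := fun _ hg =>
  mem_avoiding.2 fun j hj => mem_avoiding.1 hg j (hj.trans h)

open Classical in
/-- If the values on `R` of an assignment satisfying `B j` are determined by the values off `R`,
then `B j` costs a factor `card α ^ #R`. -/
lemma card_filter_mul_pow_le (supp : J → Finset ι) (B : J → (ι → α) → Prop)
    (hloc : ∀ j g g', (∀ x ∈ supp j, g x = g' x) → B j g → B j g')
    (T R : Finset ι) (hTR : Disjoint T R) (j : J)
    (hdet : ∀ g g', B j g → B j g' → (∀ y ∉ R, g y = g' y) → g = g') :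
    ((avoiding supp B T).filter (B j)).card * Fintype.card α ^ R.card
      ≤ (avoiding supp B T).card := by
  have hcard : Fintype.card α ^ R.card = (Finset.univ : Finset (R → α)).card := by
    simp
  rw [hcard, ← Finset.card_product]
  refine Finset.card_le_card_of_injOn
    (fun p x => if hx : x ∈ R then p.2 ⟨x, hx⟩ else p.1 x) ?_ ?_
  · rintro ⟨g, h⟩ hp
    simp only [Finset.coe_product, Set.mem_prod, Finset.mem_coe, Finset.mem_filter] at hp
    refine mem_avoiding.2 fun i hi hB => mem_avoiding.1 hp.1.1 i hi (hloc i _ _ ?_ hB)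
    intro x hx
    have : x ∉ R := Finset.disjoint_left.1 hTR (hi hx)
    simp [this]
  · rintro ⟨g, h⟩ hp ⟨g', h'⟩ hp' heq
    simp only [Finset.coe_product, Set.mem_prod, Finset.mem_coe, Finset.mem_filter] at hp hp'
    have hg : g = g' := by
      refine hdet g g' hp.1.2 hp'.1.2 fun y hy => ?_
      simpa [hy] using congrFun heq y
    have hh : h = h' := by
      funext ⟨y, hy⟩
      simpa [hy] using congrFun heq y
    rw [hg, hh]

open Classical in
/-- A counting form of the Lovász local lemma: adding one coordinate to the domain on which the
bad events are avoided loses at most half of the assignments. -/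
lemma card_avoiding_le (supp : J → Finset ι) (B : J → (ι → α) → Prop) (r : J → ℕ) (D : ℕ)
    (hD : 0 < D) (hα : Fintype.card α = 2 * D)
    (hloc : ∀ j g g', (∀ x ∈ supp j, g x = g' x) → B j g → B j g')
    (hdet : ∀ j, ∀ x ∈ supp j, ∃ R, x ∈ R ∧ R ⊆ supp j ∧ R.card = r j ∧
      ∀ g g', B j g → B j g' → (∀ y ∉ R, g y = g' y) → g = g')
    (hsum : ∀ x, ∑ j with x ∈ supp j, ((D : ℝ)⁻¹) ^ r j ≤ 1) (S : Finset ι) :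
    ∀ T ⊆ S, ((avoiding supp B T).card : ℝ) ≤ 2 ^ (S \ T).card * (avoiding supp B S).card := by
  induction S using Finset.strongInduction with
  | H S ih =>
  intro T hTS
  by_cases hST : S ⊆ T
  · rw [Finset.Subset.antisymm hTS hST]; simp
  obtain ⟨x, hxS, hxT⟩ := Finset.not_subset.1 hST
  have hss : S.erase x ⊂ S := Finset.erase_ssubset hxS
  have hTe : T ⊆ S.erase x := fun y hy =>
    Finset.mem_erase.2 ⟨fun h => hxT (h ▸ hy), hTS hy⟩
  have hstep : ((avoiding supp B (S.erase x)).card : ℝ) ≤ 2 * (avoiding supp B S).card := by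
    set M : ℝ := ((avoiding supp B (S.erase x)).card : ℝ)
    have hbad : ∀ j, x ∈ supp j → supp j ⊆ S →
        (((avoiding supp B (S.erase x)).filter (B j)).card : ℝ) ≤
          M / 2 * ((D : ℝ)⁻¹) ^ r j := by
      intro j hxj hjS
      obtain ⟨R, hxR, hRj, hRc, hR⟩ := hdet j x hxj
      have hsub : S \ R ⊆ S.erase x := fun y hy => by
        rw [Finset.mem_sdiff] at hy
        exact Finset.mem_erase.2 ⟨fun h => hy.2 (h ▸ hxR), hy.1⟩
      have h1 := card_filter_mul_pow_le supp B hloc (S \ R) R Finset.sdiff_disjoint j hR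
      have h2 := ih _ hss _ hsub
      have h3 : S.erase x \ (S \ R) = R.erase x := by
        ext y
        simp only [Finset.mem_sdiff, Finset.mem_erase]
        have := @hRj y
        have := @hjS y
        tauto
      rw [h3] at h2
      have h4 : (R.erase x).card + 1 = r j := by
        rw [Finset.card_erase_add_one hxR, hRc]
      have h5 : ((avoiding supp B (S.erase x)).filter (B j)).card ≤
          ((avoiding supp B (S \ R)).filter (B j)).card :=
        Finset.card_le_card (Finset.filter_subset_filter _ (avoiding_anti hsub))
      have h6 : (((avoiding supp B (S.erase x)).filter (B j)).card : ℝ) * (2 * D) ^ r j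
          ≤ 2 ^ (R.erase x).card * M := by
        refine le_trans ?_ h2
        rw [hα, hRc] at h1
        exact_mod_cast (Nat.mul_le_mul_right _ h5).trans h1
      rw [← h4] at h6 ⊢
      have hDpos : (0 : ℝ) < D := by exact_mod_cast hD
      rw [inv_pow, ← div_eq_mul_inv, le_div_iff₀ (by positivity)]
      rw [mul_pow, pow_succ 2] at h6
      have h7 : (0 : ℝ) < 2 ^ (R.erase x).card := by positivity
      refine le_of_mul_le_mul_left ?_ h7
      linarith
    have hcov : avoiding supp B (S.erase x) ⊆ avoiding supp B S ∪
        (Finset.univ.filter fun j => x ∈ supp j ∧ supp j ⊆ S).biUnion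
          fun j => (avoiding supp B (S.erase x)).filter (B j) := by
      intro g hg
      by_cases hgS : g ∈ avoiding supp B S
      · exact Finset.mem_union_left _ hgS
      · refine Finset.mem_union_right _ ?_
        rw [mem_avoiding] at hgS
        push Not at hgS
        obtain ⟨j, hjS, hj⟩ := hgS
        refine Finset.mem_biUnion.2 ⟨j, ?_, Finset.mem_filter.2 ⟨hg, hj⟩⟩
        refine Finset.mem_filter.2 ⟨Finset.mem_univ _, ?_, hjS⟩
        by_contra hxj
        refine mem_avoiding.1 hg j (fun y hy => ?_) hj
        exact Finset.mem_erase.2 ⟨fun h => hxj (h ▸ hy), hjS hy⟩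
    have h1 := (Finset.card_le_card hcov).trans
      ((Finset.card_union_le _ _).trans (Nat.add_le_add_left Finset.card_biUnion_le _))
    have h2 : M ≤ (avoiding supp B S).card +
        ∑ j with x ∈ supp j ∧ supp j ⊆ S,
          (((avoiding supp B (S.erase x)).filter (B j)).card : ℝ) := by
      simp only [M]
      exact_mod_cast h1
    have h3 : ∑ j with x ∈ supp j ∧ supp j ⊆ S,
          (((avoiding supp B (S.erase x)).filter (B j)).card : ℝ) ≤ M / 2 * 1 := by
      calc _ ≤ ∑ j with x ∈ supp j ∧ supp j ⊆ S, M / 2 * ((D : ℝ)⁻¹) ^ r j :=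
            Finset.sum_le_sum fun j hj => by
              rw [Finset.mem_filter] at hj
              exact hbad j hj.2.1 hj.2.2
        _ ≤ ∑ j with x ∈ supp j, M / 2 * ((D : ℝ)⁻¹) ^ r j := by
            refine Finset.sum_le_sum_of_subset_of_nonneg ?_ fun j _ _ => by positivity
            intro j hj
            rw [Finset.mem_filter] at hj ⊢
            exact ⟨hj.1, hj.2.1⟩
        _ = M / 2 * ∑ j with x ∈ supp j, ((D : ℝ)⁻¹) ^ r j := by rw [Finset.mul_sum]
        _ ≤ M / 2 * 1 := by
            refine mul_le_mul_of_nonneg_left ?_ (by positivity)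
            convert hsum x
    linarith
  have hcard : (S \ T).card = (S.erase x \ T).card + 1 := by
    rw [Finset.erase_sdiff_comm, Finset.card_erase_add_one (Finset.mem_sdiff.2 ⟨hxS, hxT⟩)]
  calc _ ≤ 2 ^ (S.erase x \ T).card * ((avoiding supp B (S.erase x)).card : ℝ) := ih _ hss T hTe
    _ ≤ 2 ^ (S.erase x \ T).card * (2 * (avoiding supp B S).card) := by gcongr
    _ = _ := by rw [hcard]; ring

lemma exists_avoiding (supp : J → Finset ι) (B : J → (ι → α) → Prop) (r : J → ℕ) (D : ℕ)
    (hD : 0 < D) (hα : Fintype.card α = 2 * D) (hne : ∀ j, (supp j).Nonempty)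
    (hloc : ∀ j g g', (∀ x ∈ supp j, g x = g' x) → B j g → B j g')
    (hdet : ∀ j, ∀ x ∈ supp j, ∃ R, x ∈ R ∧ R ⊆ supp j ∧ R.card = r j ∧
      ∀ g g', B j g → B j g' → (∀ y ∉ R, g y = g' y) → g = g')
    (hsum : ∀ x, ∑ j with x ∈ supp j, ((D : ℝ)⁻¹) ^ r j ≤ 1) :
    ∃ g, ∀ j, ¬ B j g := by
  have h := card_avoiding_le supp B r D hD hα hloc hdet hsum Finset.univ ∅ (Finset.empty_subset _)
  have : Nonempty α := Fintype.card_pos_iff.1 (by omega)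
  have hpos : 0 < (avoiding supp B ∅).card :=
    Finset.card_pos.2 ⟨fun _ => Classical.arbitrary α, mem_avoiding.2 fun j hj =>
      absurd (Finset.subset_empty.1 hj) (hne j).ne_empty⟩
  have hne' : (avoiding supp B Finset.univ).Nonempty := by
    rw [Finset.nonempty_iff_ne_empty]
    intro h0
    rw [h0] at h
    simp only [Finset.card_empty, Nat.cast_zero, mul_zero] at h
    have : (0 : ℝ) < (avoiding supp B ∅).card := by exact_mod_cast hpos
    linarith
  obtain ⟨g, hg⟩ := hne'
  exact ⟨g, fun j => mem_avoiding.1 hg j (Finset.subset_univ _)⟩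

end Counting

/-- Fixing two values of a function leaves at most `card β ^ (card ι - 2)` choices. -/
lemma card_filter_two_values_le {ι β : Type*} [Fintype ι] [DecidableEq ι] [Fintype β]
    [DecidableEq β] {a b : ι} (hab : a ≠ b) (p q : β) :
    (Finset.univ.filter fun f : ι → β => f a = p ∧ f b = q).card
      ≤ Fintype.card β ^ (Fintype.card ι - 2) := by
  have hc : Fintype.card {x // x ∉ ({a, b} : Finset ι)} = Fintype.card ι - 2 := by
    rw [Fintype.card_subtype_compl, Fintype.card_coe, Finset.card_pair hab]
  rw [← hc, ← Fintype.card_fun, ← Finset.card_univ]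
  refine Finset.card_le_card_of_injOn (fun f x => f x.1) (fun _ _ => Finset.mem_univ _) ?_
  intro f hf g hg h
  simp only [Finset.coe_filter, Finset.mem_univ, true_and, Set.mem_ofPred_eq] at hf hg
  funext x
  by_cases hxa : x = a
  · rw [hxa, hf.1, hg.1]
  by_cases hxb : x = b
  · rw [hxb, hf.2, hg.2]
  exact congrFun h ⟨x, by simp [hxa, hxb]⟩

/-- Few triples `(a, b, c)` have a given edge among `ab`, `ac`. -/
lemma card_cherries_le (n : ℕ) (x : Sym2 (Fin n)) :
    (Finset.univ.filter fun t : Fin n × Fin n × Fin n =>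
      x = s(t.1, t.2.1) ∨ x = s(t.1, t.2.2)).card ≤ 4 * n := by
  induction x using Sym2.ind with
  | _ p q =>
  have hsub : (Finset.univ.filter fun t : Fin n × Fin n × Fin n =>
      s(p, q) = s(t.1, t.2.1) ∨ s(p, q) = s(t.1, t.2.2)) ⊆
      ((Finset.univ.image fun z => (p, q, z)) ∪ (Finset.univ.image fun z => (q, p, z))) ∪
      ((Finset.univ.image fun z => (p, z, q)) ∪ (Finset.univ.image fun z => (q, z, p))) := by
    rintro ⟨a, b, b'⟩ h
    simp only [Finset.mem_filter, Finset.mem_univ, true_and, Sym2.eq_iff] at h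
    simp only [Finset.mem_union, Finset.mem_image, Finset.mem_univ, true_and, Prod.mk.injEq]
    rcases h with (⟨rfl, rfl⟩ | ⟨rfl, rfl⟩) | (⟨rfl, rfl⟩ | ⟨rfl, rfl⟩) <;> simp
  have him : ∀ f : Fin n → Fin n × Fin n × Fin n, (Finset.univ.image f).card ≤ n := fun f =>
    Finset.card_image_le.trans (by simp)
  refine (Finset.card_le_card hsub).trans ?_
  refine (Finset.card_union_le _ _).trans ?_
  have h1 := Finset.card_union_le (Finset.univ.image fun z : Fin n => (p, q, z))
    (Finset.univ.image fun z => (q, p, z))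
  have h2 := Finset.card_union_le (Finset.univ.image fun z : Fin n => (p, z, q))
    (Finset.univ.image fun z => (q, z, p))
  have := him fun z => (p, q, z)
  have := him fun z => (q, p, z)
  have := him fun z => (p, z, q)
  have := him fun z => (q, z, p)
  omega

/-- The image in `K_n` of an edge of the `i`-th copy, under an embedding of `k` copies. -/
def copyEdge {V : Type*} {k n : ℕ} (ψ : Fin k × V ↪ Fin n) (t : Fin k × Sym2 V) : Sym2 (Fin n) :=
  Sym2.map (fun u => ψ (t.1, u)) t.2

lemma copyEdge_injective {V : Type*} {k n : ℕ} (ψ : Fin k × V ↪ Fin n) : Function.Injective (copyEdge ψ) := by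
  rintro ⟨i, z⟩ ⟨j, w⟩ h
  induction z using Sym2.ind with
  | _ a b =>
  induction w using Sym2.ind with
  | _ c d =>
  simp only [copyEdge, Sym2.map_mk, Sym2.eq_iff, ψ.injective.eq_iff, Prod.mk.injEq] at h
  rw [Prod.mk.injEq, Sym2.eq_iff]
  tauto

section Copies

variable {V : Type} [Fintype V] (H : SimpleGraph V) [DecidableRel H.Adj]
  {k n : ℕ}

/-- The edges of `K_n` in the `k` copies of `H` given by an embedding. -/
def copyEdges (ψ : Fin k × V ↪ Fin n) : Finset (Sym2 (Fin n)) :=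
  (Finset.univ ×ˢ H.edgeFinset).image (copyEdge ψ)

/-- Few embeddings of `k` copies of `H` use a given edge of `K_n`. -/
lemma card_copies_le_s13 [DecidableEq V] (x : Sym2 (Fin n)) :
    (Finset.univ.filter fun ψ : Fin k × V ↪ Fin n => x ∈ copyEdges H ψ).card
      ≤ k * Fintype.card V ^ 2 * n ^ (k * Fintype.card V - 2) := by
  induction x using Sym2.ind with
  | _ p q =>
  let A : Finset (Fin k × V × V) := Finset.univ.filter fun t => t.2.1 ≠ t.2.2
  let F : Fin k × V × V → Finset (Fin k × V → Fin n) := fun t =>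
    Finset.univ.filter fun f => f (t.1, t.2.1) = p ∧ f (t.1, t.2.2) = q
  have hle : (Finset.univ.filter fun ψ : Fin k × V ↪ Fin n => s(p, q) ∈ copyEdges H ψ).card
      ≤ (A.biUnion F).card := by
    refine Finset.card_le_card_of_injOn (fun ψ => (ψ : Fin k × V → Fin n)) ?_
      (DFunLike.coe_injective.injOn)
    intro ψ hψ
    simp only [Finset.coe_filter, Finset.mem_univ, true_and, Set.mem_ofPred_eq, copyEdges,
      Finset.mem_image, Finset.mem_product] at hψ
    obtain ⟨⟨i, z⟩, hz, h⟩ := hψ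
    induction z using Sym2.ind with
    | _ u v =>
    have huv : H.Adj u v := by simpa using hz
    simp only [copyEdge, Sym2.map_mk, Sym2.eq_iff] at h
    simp only [Finset.coe_biUnion, Set.mem_iUnion, A, F, Finset.coe_filter, Finset.mem_univ,
      true_and, Set.mem_ofPred_eq, exists_prop]
    rcases h with h | h
    · exact ⟨(i, u, v), huv.ne, h⟩
    · exact ⟨(i, v, u), huv.ne', h.2, h.1⟩
  refine hle.trans (Finset.card_biUnion_le.trans ?_)
  have hF : ∀ t ∈ A, (F t).card ≤ n ^ (k * Fintype.card V - 2) := by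
    rintro ⟨i, u, v⟩ ht
    have huv : u ≠ v := by simpa [A] using ht
    have := card_filter_two_values_le (a := (i, u)) (b := (i, v)) (by simpa using huv) p q
    simpa [F] using this
  refine (Finset.sum_le_card_nsmul _ _ _ hF).trans ?_
  rw [smul_eq_mul]
  refine Nat.mul_le_mul_right _ ((Finset.card_le_univ _).trans ?_)
  simp [sq]

/-- The `k` copies of `H` given by `ψ` receive identical colours under `g`. -/
def SameColors (ψ : Fin k × V ↪ Fin n) {α : Type*} (g : Sym2 (Fin n) → α) : Prop :=
  ∀ i j, ∀ z ∈ H.edgeFinset, g (copyEdge ψ (i, z)) = g (copyEdge ψ (j, z))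

/-- Any edge of `k` colour-identical copies lies in a set of `(k - 1) * e` edges, namely the edges
of all copies but one, whose colours are determined by the other colours. -/
lemma exists_determined (hk : 2 ≤ k) (ψ : Fin k × V ↪ Fin n) {α : Type*} {x : Sym2 (Fin n)}
    (hx : x ∈ copyEdges H ψ) :
    ∃ R, x ∈ R ∧ R ⊆ copyEdges H ψ ∧ R.card = (k - 1) * H.edgeFinset.card ∧
      ∀ g g' : Sym2 (Fin n) → α, SameColors H ψ g → SameColors H ψ g' →
        (∀ y ∉ R, g y = g' y) → g = g' := by
  obtain ⟨⟨i, z⟩, hz, rfl⟩ := Finset.mem_image.1 hx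
  have hz' : z ∈ H.edgeFinset := (Finset.mem_product.1 hz).2
  have : Nontrivial (Fin k) := Fin.nontrivial_iff_two_le.2 hk
  obtain ⟨j, hj⟩ := exists_ne i
  refine ⟨((Finset.univ.erase j) ×ˢ H.edgeFinset).image (copyEdge ψ), ?_, ?_, ?_, ?_⟩
  · exact Finset.mem_image_of_mem _
      (Finset.mem_product.2 ⟨Finset.mem_erase.2 ⟨hj.symm, Finset.mem_univ _⟩, hz'⟩)
  · exact Finset.image_subset_image (Finset.product_subset_product_left (Finset.erase_subset _ _))
  · rw [Finset.card_image_of_injective _ (copyEdge_injective ψ), Finset.card_product,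
      Finset.card_erase_of_mem (Finset.mem_univ _), Finset.card_univ, Fintype.card_fin]
  · intro g g' hg hg' h
    funext y
    by_cases hy : y ∈ ((Finset.univ.erase j) ×ˢ H.edgeFinset).image (copyEdge ψ)
    · obtain ⟨⟨l, w⟩, hw, rfl⟩ := Finset.mem_image.1 hy
      have hw' : w ∈ H.edgeFinset := (Finset.mem_product.1 hw).2
      rw [hg l j w hw', hg' l j w hw']
      refine h _ fun hmem => ?_
      obtain ⟨t, ht, hte⟩ := Finset.mem_image.1 hmem
      rw [copyEdge_injective ψ hte] at ht
      simp at ht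
    · exact h y hy

/-- `2 * D` colours suffice as soon as `D` is large compared with the number of conflicts. -/
lemma repeatNumber_le_s13 [DecidableEq V] (he : 1 ≤ H.edgeFinset.card) (hk : 2 ≤ k) (D : ℕ) (hD : 0 < D)
    (hDn : 8 * n ≤ D)
    (hDk : 2 * (k * Fintype.card V ^ 2 * n ^ (k * Fintype.card V - 2)) ≤
      D ^ ((k - 1) * H.edgeFinset.card)) :
    repeatNumber k n H ≤ 2 * D := by
  classical
  have hDpos : (0 : ℝ) < D := by exact_mod_cast hD
  let supp : (Fin n × Fin n × Fin n) ⊕ (Fin k × V ↪ Fin n) → Finset (Sym2 (Fin n)) :=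
    Sum.elim (fun t => {s(t.1, t.2.1), s(t.1, t.2.2)}) (copyEdges H)
  let B : (Fin n × Fin n × Fin n) ⊕ (Fin k × V ↪ Fin n) → (Sym2 (Fin n) → Fin (2 * D)) → Prop :=
    Sum.elim (fun t g => t.2.1 ≠ t.2.2 ∧ g s(t.1, t.2.1) = g s(t.1, t.2.2))
      (fun ψ g => SameColors H ψ g)
  let r : (Fin n × Fin n × Fin n) ⊕ (Fin k × V ↪ Fin n) → ℕ :=
    Sum.elim (fun _ => 1) (fun _ => (k - 1) * H.edgeFinset.card)
  obtain ⟨g, hg⟩ : ∃ g, ∀ j, ¬ B j g := by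
    refine exists_avoiding supp B r D hD (by simp) ?_ ?_ ?_ ?_
    · rintro (t | ψ)
      · exact ⟨s(t.1, t.2.1), by simp [supp]⟩
      · refine Finset.Nonempty.image (Finset.Nonempty.product ?_ (Finset.card_pos.1 he)) _
        exact ⟨⟨0, by omega⟩, Finset.mem_univ _⟩
    · rintro (t | ψ) g g' h hB
      · refine ⟨hB.1, ?_⟩
        rw [← h _ (by simp [supp]), ← h _ (by simp [supp])]
        exact hB.2
      · intro i j z hz
        have hmem : ∀ i, copyEdge ψ (i, z) ∈ supp (Sum.inr ψ) := fun i =>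
          Finset.mem_image_of_mem _ (Finset.mem_product.2 ⟨Finset.mem_univ _, hz⟩)
        rw [← h _ (hmem i), ← h _ (hmem j)]
        exact hB i j z hz
    · rintro (⟨a, b, b'⟩ | ψ) x hx
      · refine ⟨{x}, by simp, by simpa using hx, by simp [r], ?_⟩
        rintro g g' ⟨hne, hg⟩ ⟨-, hg'⟩ h
        simp only at hne hg hg'
        have hne' : s(a, b) ≠ s(a, b') := fun h => hne (Sym2.congr_right.1 h)
        simp only [supp, Sum.elim_inl, Finset.mem_insert, Finset.mem_singleton] at hx
        funext y
        by_cases hy : y = x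
        · subst hy
          rcases hx with rfl | rfl
          · rw [hg, hg']
            exact h _ (by simpa using hne'.symm)
          · rw [← hg, ← hg']
            exact h _ (by simpa using hne')
        · exact h y (by simpa using hy)
      · exact exists_determined H hk ψ hx
    · intro x
      rw [Finset.sum_filter, Fintype.sum_sum_type, ← Finset.sum_filter, ← Finset.sum_filter]
      simp only [r, Sum.elim_inl, Sum.elim_inr, Finset.sum_const, nsmul_eq_mul, pow_one]
      have h1 : ((Finset.univ.filter fun t : Fin n × Fin n × Fin n =>
          x ∈ supp (Sum.inl t)).card : ℝ) * (D : ℝ)⁻¹ ≤ 1 / 2 := by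
        have h := card_cherries_le n x
        have h' : 2 * (Finset.univ.filter fun t : Fin n × Fin n × Fin n =>
            x ∈ supp (Sum.inl t)).card ≤ D := by
          simp only [supp, Sum.elim_inl, Finset.mem_insert, Finset.mem_singleton]
          omega
        rw [← div_eq_mul_inv, div_le_iff₀ hDpos]
        have : (2 : ℝ) * (Finset.univ.filter fun t : Fin n × Fin n × Fin n =>
            x ∈ supp (Sum.inl t)).card ≤ D := by exact_mod_cast h'
        linarith
      have h2 : ((Finset.univ.filter fun ψ : Fin k × V ↪ Fin n =>
          x ∈ supp (Sum.inr ψ)).card : ℝ) * (D : ℝ)⁻¹ ^ ((k - 1) * H.edgeFinset.card) ≤ 1 / 2 := by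
        have h : (Finset.univ.filter fun ψ : Fin k × V ↪ Fin n => x ∈ supp (Sum.inr ψ)).card ≤ _ :=
          card_copies_le_s13 H x
        have h' := (Nat.mul_le_mul_left 2 h).trans hDk
        rw [inv_pow, ← div_eq_mul_inv, div_le_iff₀ (by positivity)]
        have : (2 : ℝ) * (Finset.univ.filter fun ψ : Fin k × V ↪ Fin n =>
            x ∈ supp (Sum.inr ψ)).card ≤ D ^ ((k - 1) * H.edgeFinset.card) := by exact_mod_cast h'
        linarith
      linarith
  let c : Fin n → Fin n → ℕ := fun a b => (g s(a, b)).val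
  have hmem : numColors n c ∈ { C | ∃ c : Fin n → Fin n → ℕ,
      IsProperEdgeColoring n c ∧ numColors n c = C ∧ ¬ HasRepeat n k H c } := by
    refine ⟨c, ⟨fun a b => by simp only [c, Sym2.eq_swap], ?_⟩, rfl, ?_⟩
    · intro a b b' _ _ hbb h
      exact hg (Sum.inl (a, b, b')) ⟨hbb, Fin.val_injective h⟩
    · rintro ⟨φ, hinj, hdisj, hcol⟩
      let ψ : Fin k × V ↪ Fin n := ⟨fun t => φ t.1 t.2, by
        rintro ⟨i, u⟩ ⟨j, v⟩ h
        by_cases hij : i = j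
        · subst hij
          rw [hinj i (show φ i u = φ i v from h)]
        · exact absurd h (hdisj i j hij u v)⟩
      refine hg (Sum.inr ψ) fun i j z hz => ?_
      induction z using Sym2.ind with
      | _ u v =>
      exact Fin.val_injective (hcol i j u v (by simpa using hz))
  refine (Nat.sInf_le hmem).trans ?_
  calc numColors n c ≤ (Finset.range (2 * D)).card := by
        refine Finset.card_le_card fun y hy => ?_
        obtain ⟨p, -, rfl⟩ := Finset.mem_image.1 hy
        exact Finset.mem_range.2 (g s(p.1, p.2)).isLt
    _ = 2 * D := Finset.card_range _

end Copies

/-- For any graph `H` with `v` vertices and `e ≥ 1` edges and any `k ≥ 2`,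
`f_k(n,H) = O(max{n, n^{(kv-2)/((k-1)e)}})`. -/
theorem stmt_13 (V : Type) [Fintype V] [DecidableEq V] (H : SimpleGraph V)
    [DecidableRel H.Adj] (he : 1 ≤ H.edgeFinset.card) (k : ℕ) (hk : 2 ≤ k) :
    ∃ c : ℝ, 0 < c ∧ ∃ n₀ : ℕ, ∀ n ≥ n₀,
      (repeatNumber k n H : ℝ) ≤
        c * max (n : ℝ) ((n : ℝ) ^
          (((k : ℝ) * (Fintype.card V : ℝ) - 2) /
            (((k : ℝ) - 1) * (H.edgeFinset.card : ℝ)))) := by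
  set v := Fintype.card V with hv
  set e := H.edgeFinset.card with hee
  set K : ℕ := k * v ^ 2 with hK
  have hv2 : 2 ≤ v := by
    obtain ⟨z, hz⟩ := Finset.card_pos.1 he
    induction z using Sym2.ind with
    | _ a b =>
    have hab : H.Adj a b := by simpa using hz
    exact Fintype.one_lt_card_iff.2 ⟨a, b, hab.ne⟩
  have hm : 1 ≤ (k - 1) * e := Nat.mul_pos (by omega) he
  have hkv : 2 ≤ k * v := hk.trans (Nat.le_mul_of_pos_right k (by omega))
  refine ⟨2 * (8 + 2 * K + 1), by positivity, 1, fun n hn => ?_⟩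
  have hn1 : (1 : ℝ) ≤ n := by exact_mod_cast hn
  set β : ℝ := ((k : ℝ) * (v : ℝ) - 2) / (((k : ℝ) - 1) * (e : ℝ)) with hβ
  set X : ℝ := max (n : ℝ) ((n : ℝ) ^ β) with hX
  have hX1 : 1 ≤ X := hn1.trans (le_max_left _ _)
  have hX0 : 0 ≤ X := by linarith
  set D : ℕ := ⌈(8 + 2 * K : ℝ) * X⌉₊ with hDdef
  have hDX : (8 + 2 * K : ℝ) * X ≤ D := Nat.le_ceil _
  have hK0 : (0 : ℝ) ≤ K := Nat.cast_nonneg _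
  have hD1 : (8 * n : ℝ) ≤ D := by
    refine le_trans ?_ hDX
    have : (n : ℝ) ≤ X := le_max_left _ _
    nlinarith [mul_nonneg hK0 hX0]
  have hD8 : 8 * n ≤ D := by exact_mod_cast hD1
  have hpow : (n : ℝ) ^ (k * v - 2) ≤ X ^ ((k - 1) * e) := by
    have hexp : β * (((k - 1) * e : ℕ) : ℝ) = ((k * v - 2 : ℕ) : ℝ) := by
      have hne : (((k - 1) * e : ℕ) : ℝ) ≠ 0 := by exact_mod_cast (by omega)
      have hcast : (((k - 1) * e : ℕ) : ℝ) = ((k : ℝ) - 1) * e := by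
        rw [Nat.cast_mul, Nat.cast_sub (by omega), Nat.cast_one]
      rw [hβ, ← hcast, div_mul_cancel₀ _ hne, Nat.cast_sub hkv]
      push_cast
      ring
    calc (n : ℝ) ^ (k * v - 2) = ((n : ℝ) ^ β) ^ ((k - 1) * e) := by
          rw [← Real.rpow_natCast ((n : ℝ) ^ β), ← Real.rpow_mul (by linarith), hexp,
            Real.rpow_natCast]
      _ ≤ X ^ ((k - 1) * e) := pow_le_pow_left₀ (by positivity) (le_max_right _ _) _
  have hDk : (2 * (K * n ^ (k * v - 2)) : ℝ) ≤ (D : ℝ) ^ ((k - 1) * e) :=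
    calc (2 * (K * n ^ (k * v - 2)) : ℝ) = 2 * K * (n : ℝ) ^ (k * v - 2) := by ring
      _ ≤ (8 + 2 * K) ^ ((k - 1) * e) * X ^ ((k - 1) * e) := by
          refine mul_le_mul ?_ hpow (by positivity) (by positivity)
          have := le_self_pow₀ (a := (8 + 2 * K : ℝ)) (by linarith)
            (show (k - 1) * e ≠ 0 by omega)
          linarith
      _ = ((8 + 2 * K : ℝ) * X) ^ ((k - 1) * e) := (mul_pow _ _ _).symm
      _ ≤ (D : ℝ) ^ ((k - 1) * e) := pow_le_pow_left₀ (by positivity) hDX _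
  have hmain := repeatNumber_le_s13 (n := n) H he hk D (by omega) hD8 (by exact_mod_cast hDk)
  have hmain' : (repeatNumber k n H : ℝ) ≤ 2 * D := by exact_mod_cast hmain
  have hDup : (D : ℝ) < (8 + 2 * K : ℝ) * X + 1 := Nat.ceil_lt_add_one (by positivity)
  nlinarith
end

section
/- For any tree T with m ≥ 1 edges, there exists n₀ such that for all n ≥ n₀, f₂(n,T) ≥ n²/(24(2m+1)). -/
open Finset

/-- A finite set spanning more than `2 * k * |S|` ordered pairs of a symmetric relation contains a
nonempty subset in which every element has at least `k` neighbours. -/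
theorem exists_subset_forall_le_card_filter {α : Type*} [DecidableEq α] (adj : α → α → Prop)
    [∀ x y, Decidable (adj x y)] (hsymm : ∀ x y, adj x y → adj y x) (S₀ : Finset α) (k : ℕ)
    (h : 2 * k * S₀.card < ((S₀ ×ˢ S₀).filter fun p => adj p.1 p.2).card) :
    ∃ S ⊆ S₀, S.Nonempty ∧ ∀ x ∈ S, k ≤ (S.filter (adj x)).card := by
  let f : Finset α → ℤ := fun S =>
    (((S ×ˢ S).filter fun p => adj p.1 p.2).card : ℤ) - 2 * k * S.card
  obtain ⟨S, hS, hmax⟩ := S₀.powerset.exists_max_image f ⟨S₀, mem_powerset_self _⟩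
  have hpos : 0 < f S := by
    refine lt_of_lt_of_le ?_ (hmax S₀ (mem_powerset_self _))
    simp only [f]
    have : ((2 * k * S₀.card : ℕ) : ℤ) <
        (((S₀ ×ˢ S₀).filter fun p => adj p.1 p.2).card : ℤ) := by exact_mod_cast h
    push_cast at this
    linarith
  refine ⟨S, mem_powerset.1 hS, ?_, fun x hx => ?_⟩
  · rw [nonempty_iff_ne_empty]
    rintro rfl
    simp [f] at hpos
  · have hle := hmax (S.erase x)
      (mem_powerset.2 ((erase_subset _ _).trans (mem_powerset.1 hS)))
    have hsub : ((S ×ˢ S).filter fun p => adj p.1 p.2) ⊆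
        (((S.erase x) ×ˢ (S.erase x)).filter fun p => adj p.1 p.2) ∪
          ((S.filter (adj x)).image (fun y => (x, y)) ∪
            (S.filter (adj x)).image (fun y => (y, x))) := by
      rintro ⟨a, b⟩ hab
      simp only [mem_filter, mem_product, mem_union, mem_image, mem_erase, Prod.mk.injEq] at hab ⊢
      by_cases ha : a = x
      · subst ha
        exact Or.inr (Or.inl ⟨b, ⟨hab.1.2, hab.2⟩, rfl, rfl⟩)
      · by_cases hb : b = x
        · subst hb
          exact Or.inr (Or.inr ⟨a, ⟨hab.1.1, hsymm _ _ hab.2⟩, rfl, rfl⟩)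
        · exact Or.inl ⟨⟨⟨ha, hab.1.1⟩, hb, hab.1.2⟩, hab.2⟩
    have hcard := (card_le_card hsub).trans ((card_union_le _ _).trans
      (Nat.add_le_add_left ((card_union_le _ _).trans
        (Nat.add_le_add card_image_le card_image_le)) _))
    have herase := card_erase_add_one hx
    simp only [f] at hle
    have h1 : (S.card : ℤ) = (S.erase x).card + 1 := by exact_mod_cast herase.symm
    rw [h1] at hle
    have h2 : (2 * k : ℤ) ≤ 2 * ((S.filter (adj x)).card : ℤ) := by
      zify at hcard
      linarith
    omega

/-- Greedy embedding of a tree: if every element of `S` has a neighbour in `S` avoiding conflicts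
with any prescribed set of at most `m` elements, then every tree with at most `m + 1` vertices
embeds in `S` without conflicts. -/
theorem exists_conflict_free_tree_embedding {α : Type*} [DecidableEq α] (adj R : α → α → Prop)
    (hadj : ∀ x y, adj x y → adj y x) (hR : ∀ x y, R x y → R y x) (S : Finset α)
    (hS : S.Nonempty) (m : ℕ)
    (hext : ∀ x ∈ S, ∀ F : Finset α, F.card ≤ m → ∃ y ∈ S, adj x y ∧ ∀ z ∈ F, ¬ R y z)
    (N : ℕ) (hN : N ≤ m) (V : Type*) [Fintype V] (T : SimpleGraph V) (hT : T.IsTree)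
    (hV : Fintype.card V = N + 1) :
    ∃ φ : V → α, (∀ v, φ v ∈ S) ∧ (∀ u v, T.Adj u v → adj (φ u) (φ v)) ∧
      ∀ u v, u ≠ v → ¬ R (φ u) (φ v) := by
  classical
  induction N generalizing V with
  | zero =>
    obtain ⟨s, hs⟩ := hS
    have : Subsingleton V := Fintype.card_le_one_iff_subsingleton.1 hV.le
    exact ⟨fun _ => s, fun _ => hs, fun u v h => absurd (Subsingleton.elim u v) h.ne,
      fun u v h => absurd (Subsingleton.elim u v) h⟩
  | succ N ih =>
    have : Nontrivial V := Fintype.one_lt_card_iff_nontrivial.1 (by omega)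
    obtain ⟨v, hv⟩ := hT.exists_vert_degree_one_of_nontrivial
    have hT' : (T.induce {v}ᶜ).IsTree :=
      ⟨hT.connected.induce_compl_singleton_of_degree_eq_one hv, hT.isAcyclic.induce _⟩
    have hcard : Fintype.card ({v}ᶜ : Set V) = N + 1 := by
      rw [← Set.toFinset_card, Set.toFinset_compl, Set.toFinset_singleton, card_compl,
        card_singleton, hV, Nat.add_sub_cancel]
    obtain ⟨φ, hφS, hφadj, hφR⟩ := ih (by omega) _ (T.induce {v}ᶜ) hT' hcard
    obtain ⟨u, hvu, huniq⟩ := SimpleGraph.degree_eq_one_iff_existsUnique_adj.1 hv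
    obtain ⟨y, hyS, hy, hyF⟩ := hext (φ ⟨u, hvu.ne'⟩) (hφS _) (univ.image φ)
      (card_image_le.trans (by rw [card_univ, hcard]; omega))
    refine ⟨fun w => if h : w = v then y else φ ⟨w, h⟩, fun w => ?_, fun a b hab => ?_,
      fun a b hab => ?_⟩
    · dsimp only
      split_ifs
      exacts [hyS, hφS _]
    · dsimp only
      split_ifs with ha hb hb
      · exact absurd (ha.trans hb.symm) hab.ne
      · subst ha
        obtain rfl := huniq b hab
        exact hadj _ _ hy
      · subst hb
        obtain rfl := huniq a hab.symm
        exact hy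
      · exact hφadj _ _ hab
    · dsimp only
      split_ifs with ha hb hb
      · exact absurd (ha.trans hb.symm) hab
      · exact hyF _ (mem_image_of_mem _ (mem_univ _))
      · exact fun h => hyF _ (mem_image_of_mem _ (mem_univ _)) (hR _ _ h)
      · exact hφR _ _ fun h => hab (congrArg Subtype.val h)

/-- Two pairs of vertices are linked when the pairs have distinct entries and the edges joining
their first, respectively second, entries have the same colour. -/
def PairLinked {n : ℕ} (c : Fin n → Fin n → ℕ) (p q : Fin n × Fin n) : Prop :=
  p.1 ≠ p.2 ∧ q.1 ≠ q.2 ∧ p.1 ≠ q.1 ∧ p.2 ≠ q.2 ∧ c p.1 q.1 = c p.2 q.2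

instance {n : ℕ} (c : Fin n → Fin n → ℕ) (p q : Fin n × Fin n) : Decidable (PairLinked c p q) := by
  unfold PairLinked
  infer_instance

/-- Two pairs of vertices meet when they have an entry in common. -/
def PairMeets {α : Type*} (p q : α × α) : Prop :=
  p.1 = q.1 ∨ p.1 = q.2 ∨ p.2 = q.1 ∨ p.2 = q.2

instance {α : Type*} [DecidableEq α] (p q : α × α) : Decidable (PairMeets p q) := by
  unfold PairMeets
  infer_instance

/-- The pairs linked to `x` in a proper colouring are determined by either entry. -/
theorem card_filter_pairLinked_pairMeets_le {n : ℕ} {c : Fin n → Fin n → ℕ}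
    (hc : IsProperEdgeColoring n c) (S : Finset (Fin n × Fin n)) (x z : Fin n × Fin n) :
    (S.filter fun y => PairLinked c x y ∧ PairMeets y z).card ≤ 4 := by
  have h1 : ∀ t, (S.filter fun y => PairLinked c x y ∧ y.1 = t).card ≤ 1 := fun t => by
    refine card_le_one.2 fun a ha b hb => ?_
    simp only [mem_filter] at ha hb
    obtain ⟨-, ⟨-, -, -, ha2, ha3⟩, rfl⟩ := ha
    obtain ⟨-, ⟨-, -, -, hb2, hb3⟩, hab⟩ := hb
    refine Prod.ext hab.symm ?_
    by_contra hne
    exact hc.2 x.2 a.2 b.2 ha2 hb2 hne (by rw [← ha3, ← hb3, hab])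
  have h2 : ∀ t, (S.filter fun y => PairLinked c x y ∧ y.2 = t).card ≤ 1 := fun t => by
    refine card_le_one.2 fun a ha b hb => ?_
    simp only [mem_filter] at ha hb
    obtain ⟨-, ⟨-, -, ha2, -, ha3⟩, rfl⟩ := ha
    obtain ⟨-, ⟨-, -, hb2, -, hb3⟩, hab⟩ := hb
    refine Prod.ext ?_ hab.symm
    by_contra hne
    exact hc.2 x.1 a.1 b.1 ha2 hb2 hne (by rw [ha3, hb3, hab])
  have hsub : (S.filter fun y => PairLinked c x y ∧ PairMeets y z) ⊆
      ((S.filter fun y => PairLinked c x y ∧ y.1 = z.1) ∪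
        (S.filter fun y => PairLinked c x y ∧ y.1 = z.2)) ∪
      ((S.filter fun y => PairLinked c x y ∧ y.2 = z.1) ∪
        (S.filter fun y => PairLinked c x y ∧ y.2 = z.2)) := by
    intro y hy
    obtain ⟨hyS, hxy, hyz⟩ := mem_filter.1 hy
    unfold PairMeets at hyz
    simp only [mem_filter, mem_union]
    tauto
  refine (card_le_card hsub).trans ((card_union_le _ _).trans ?_)
  have := card_union_le (S.filter fun y => PairLinked c x y ∧ y.1 = z.1)
    (S.filter fun y => PairLinked c x y ∧ y.1 = z.2)
  have := card_union_le (S.filter fun y => PairLinked c x y ∧ y.2 = z.1)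
    (S.filter fun y => PairLinked c x y ∧ y.2 = z.2)
  have := h1 z.1
  have := h1 z.2
  have := h2 z.1
  have := h2 z.2
  omega

/-- A set of pairs in which every pair is linked to more than `4 * m` others yields two disjoint
colour-isomorphic copies of every tree with `m` edges. -/
theorem hasRepeat_two_of_forall_lt_card_filter {n : ℕ} {c : Fin n → Fin n → ℕ}
    (hc : IsProperEdgeColoring n c) {S : Finset (Fin n × Fin n)} (hS : S.Nonempty) (m : ℕ)
    (hdeg : ∀ x ∈ S, 4 * m < (S.filter (PairLinked c x)).card)
    {V : Type*} [Fintype V] {T : SimpleGraph V} (hT : T.IsTree) (hV : Fintype.card V = m + 1) :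
    HasRepeat n 2 T c := by
  have hne : ∀ x ∈ S, x.1 ≠ x.2 := fun x hx => by
    obtain ⟨y, hy⟩ := card_pos.1 ((Nat.zero_le _).trans_lt (hdeg x hx))
    exact (mem_filter.1 hy).2.1
  obtain ⟨φ, hφS, hφadj, hφR⟩ := exists_conflict_free_tree_embedding (PairLinked c) PairMeets
    (fun x y ⟨h1, h2, h3, h4, h5⟩ =>
      ⟨h2, h1, h3.symm, h4.symm, by rw [hc.1 y.1, hc.1 y.2, h5]⟩)
    (fun x y h => by simp only [PairMeets] at h ⊢; grind) S hS m
    (fun x hx F hF => by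
      by_contra! hcon
      have hsub : S.filter (PairLinked c x) ⊆
          F.biUnion fun z => S.filter fun y => PairLinked c x y ∧ PairMeets y z := by
        intro y hy
        obtain ⟨hyS, hy⟩ := mem_filter.1 hy
        obtain ⟨z, hz, hyz⟩ := hcon y hyS hy
        exact mem_biUnion.2 ⟨z, hz, mem_filter.2 ⟨hyS, hy, hyz⟩⟩
      have h1 := (card_le_card hsub).trans (card_biUnion_le_card_mul _ _ 4
        fun z _ => card_filter_pairLinked_pairMeets_le hc S x z)
      have h2 := hdeg x hx
      omega) m le_rfl V T hT hV
  refine ⟨fun i v => if i = 0 then (φ v).1 else (φ v).2, fun i u v huv => ?_,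
    fun i j hij u v => ?_, fun i j u v huv => ?_⟩
  · by_contra hne'
    refine hφR u v hne' ?_
    dsimp only at huv
    unfold PairMeets
    split_ifs at huv <;> tauto
  · have hR := hφR u v
    have hu := hne _ (hφS u)
    unfold PairMeets at hR
    by_cases huv : u = v
    · subst huv
      fin_cases i <;> fin_cases j <;> simp_all [hu.symm]
    · have := hR huv
      fin_cases i <;> fin_cases j <;> simp_all
  · have := (hφadj u v huv).2.2.2.2
    fin_cases i <;> fin_cases j <;> simp [this]

/-- Cauchy–Schwarz lower bound for the number of linked ordered pairs. -/
theorem sq_le_numColors_mul_card_pairLinked {n : ℕ} {c : Fin n → Fin n → ℕ}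
    (hc : IsProperEdgeColoring n c) :
    (n * n - n) ^ 2 ≤ numColors n c *
      (((univ ×ˢ univ : Finset ((Fin n × Fin n) × (Fin n × Fin n))).filter
        fun p => PairLinked c p.1 p.2).card + (n * n - n)) := by
  set E := Finset.univ.filter fun p : Fin n × Fin n => p.1 ≠ p.2 with hE
  have hEcard : E.card = n * n - n := by
    have : E = (univ : Finset (Fin n)).offDiag := by
      ext p
      simp [hE]
    rw [this, offDiag_card, card_univ, Fintype.card_fin]
  set P := (E ×ˢ E).filter fun p => c p.1.1 p.1.2 = c p.2.1 p.2.2 with hP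
  have hPsum : P.card = ∑ i ∈ E.image (fun p => c p.1 p.2),
      (E.filter fun p => c p.1 p.2 = i).card ^ 2 := by
    rw [card_eq_sum_card_fiberwise (f := fun p => c p.1.1 p.1.2)
      (t := E.image (fun p => c p.1 p.2))]
    · refine sum_congr rfl fun i _ => ?_
      rw [sq, ← card_product]
      congr 1
      ext p
      simp only [hP, mem_filter, mem_product]
      grind
    · intro p hp
      exact mem_image_of_mem (fun p => c p.1 p.2) (mem_product.1 (mem_filter.1 hp).1).1
  have hCS : E.card ^ 2 ≤ numColors n c * P.card := by
    rw [hPsum, card_eq_sum_card_image (fun p => c p.1 p.2) E]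
    exact sq_sum_le_card_mul_sum_sq
  have hPle : P.card ≤ ((univ ×ˢ univ : Finset ((Fin n × Fin n) × (Fin n × Fin n))).filter
        fun p => PairLinked c p.1 p.2).card + E.card := by
    have hsub : P ⊆
        ((univ ×ˢ univ : Finset ((Fin n × Fin n) × (Fin n × Fin n))).filter
          fun p => PairLinked c p.1 p.2).image (fun p => ((p.1.1, p.2.1), (p.1.2, p.2.2))) ∪
        E.image fun e => (e, e) := by
      rintro ⟨⟨a, a'⟩, ⟨b, b'⟩⟩ hp
      simp only [hP, hE, mem_filter, mem_product, mem_univ, true_and] at hp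
      obtain ⟨⟨ha, hb⟩, hcol⟩ := hp
      simp only [mem_union, mem_image, mem_filter, mem_product, mem_univ, true_and, hE]
      by_cases hab : a = b
      · subst hab
        by_cases hab' : a' = b'
        · subst hab'
          exact Or.inr ⟨(a, a'), ha, rfl⟩
        · exact absurd hcol (hc.2 _ _ _ ha hb hab')
      · by_cases hab' : a' = b'
        · subst hab'
          rw [hc.1 a, hc.1 b] at hcol
          exact absurd hcol (hc.2 _ _ _ (Ne.symm ha) (Ne.symm hb) hab)
        · exact Or.inl ⟨((a, b), (a', b')), ⟨hab, hab', ha, hb, hcol⟩, rfl⟩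
    exact (card_le_card hsub).trans ((card_union_le _ _).trans
      (Nat.add_le_add card_image_le card_image_le))
  rw [← hEcard]
  exact hCS.trans (Nat.mul_le_mul_left _ hPle)

/-- A proper colouring in which no colour is repeated has no two disjoint colour-isomorphic copies
of a graph with an edge. -/
theorem exists_isProperEdgeColoring_not_hasRepeat (n : ℕ) {V : Type*} {H : SimpleGraph V}
    {u v : V} (huv : H.Adj u v) :
    ∃ c, IsProperEdgeColoring n c ∧ ¬ HasRepeat n 2 H c := by
  obtain ⟨code, hcode⟩ := Countable.exists_injective_nat (Sym2 (Fin n))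
  refine ⟨fun a b => code s(a, b), ⟨fun a b => congrArg code Sym2.eq_swap, ?_⟩, ?_⟩
  · intro a b b' _ _ hbb' h
    exact hbb' (Sym2.congr_right.1 (hcode h))
  · rintro ⟨φ, -, hdisj, hcol⟩
    have h := hcode (hcol 0 1 u v huv)
    rcases Sym2.eq_iff.1 h with h | h
    · exact hdisj 0 1 (by decide) _ _ h.1
    · exact hdisj 0 1 (by decide) _ _ h.1

/-- For any tree `T` with `m ≥ 1` edges, `f₂(n,T) ≥ n²/(24(2m+1))` for all
sufficiently large `n`. -/
theorem stmt_16 (V : Type) [Fintype V] [DecidableEq V] (T : SimpleGraph V)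
    [DecidableRel T.Adj] (hT : T.IsTree) (m : ℕ) (hm : 1 ≤ m)
    (hme : T.edgeFinset.card = m) :
    ∃ n₀ : ℕ, ∀ n ≥ n₀,
      (n : ℝ) ^ 2 / (24 * (2 * (m : ℝ) + 1)) ≤ (repeatNumber 2 n T : ℝ) := by
  refine ⟨2, fun n hn => ?_⟩
  have hV : Fintype.card V = m + 1 := by rw [← hT.card_edgeFinset, hme]
  have : Nontrivial V := Fintype.one_lt_card_iff_nontrivial.1 (by omega)
  obtain ⟨u, v, huv⟩ : ∃ u v, T.Adj u v := by
    obtain ⟨u⟩ := hT.connected.nonempty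
    exact ⟨u, hT.connected.preconnected.exists_adj_of_nontrivial u⟩
  obtain ⟨c₀, hc₀, hr₀⟩ := exists_isProperEdgeColoring_not_hasRepeat n huv
  obtain ⟨c, hc, hnum, hrep⟩ := Nat.sInf_mem (s := { C | ∃ c : Fin n → Fin n → ℕ,
    IsProperEdgeColoring n c ∧ numColors n c = C ∧ ¬ HasRepeat n 2 T c })
    ⟨_, c₀, hc₀, rfl, hr₀⟩
  change numColors n c = repeatNumber 2 n T at hnum
  rw [← hnum]
  by_contra! hlt
  apply hrep
  rw [lt_div_iff₀ (by positivity)] at hlt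
  have hCS := sq_le_numColors_mul_card_pairLinked hc
  set D := ((univ ×ˢ univ : Finset ((Fin n × Fin n) × (Fin n × Fin n))).filter
        fun p => PairLinked c p.1 p.2).card with hD
  have hD_lower : 2 * (4 * m + 1) * (univ : Finset (Fin n × Fin n)).card < D := by
    rw [card_univ, Fintype.card_prod, Fintype.card_fin]
    have hnat : numColors n c * (24 * (2 * m + 1)) < n ^ 2 := by exact_mod_cast hlt
    obtain ⟨k, rfl⟩ : ∃ k, n = k + 1 := ⟨n - 1, by omega⟩
    have hsub : (k + 1) * (k + 1) - (k + 1) = (k + 1) * k := by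
      rw [← Nat.mul_sub_one, Nat.add_sub_cancel]
    rw [hsub] at hCS
    set C := numColors (k + 1) c
    have hk : 1 ≤ k := by omega
    have h1 : (k + 1) ^ 2 * (24 * (2 * m + 1) * k ^ 2) ≤
        (k + 1) ^ 2 * (D + (k + 1) * k) := by
      calc (k + 1) ^ 2 * (24 * (2 * m + 1) * k ^ 2)
          = ((k + 1) * k) ^ 2 * (24 * (2 * m + 1)) := by ring
        _ ≤ C * (D + (k + 1) * k) * (24 * (2 * m + 1)) := Nat.mul_le_mul_right _ hCS
        _ = C * (24 * (2 * m + 1)) * (D + (k + 1) * k) := by ring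
        _ ≤ (k + 1) ^ 2 * (D + (k + 1) * k) := Nat.mul_le_mul_right _ hnat.le
    have h2 := Nat.le_of_mul_le_mul_left h1 (by positivity)
    have h3 : (k + 1) * (k + 1) ≤ 4 * k ^ 2 := by nlinarith
    have h4 : (k + 1) * k ≤ 2 * k ^ 2 := by nlinarith
    have h5 : 2 * (4 * m + 1) * ((k + 1) * (k + 1)) ≤ 2 * (4 * m + 1) * (4 * k ^ 2) :=
      Nat.mul_le_mul_left _ h3
    have h6 : 0 < k ^ 2 := by positivity
    nlinarith [Nat.zero_le (m * k ^ 2)]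
  obtain ⟨S, -, hS, hdeg⟩ := exists_subset_forall_le_card_filter (PairLinked c)
    (fun x y ⟨h1, h2, h3, h4, h5⟩ =>
      ⟨h2, h1, h3.symm, h4.symm, by rw [hc.1 y.1, hc.1 y.2, h5]⟩)
    univ (4 * m + 1) hD_lower
  exact hasRepeat_two_of_forall_lt_card_filter hc hS m (fun x hx => hdeg x hx) hT hV
end

section
/- For every tree T with m ≥ 2 edges, f₂(n,T) ≤ (1 + o(1))·n²/(2m); that is, for every ε > 0 there exists n₀ such that for all n ≥ n₀, f₂(n,T) ≤ (1 + ε)·n²/(2m). -/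
open Finset

/-- A family of `b` injectively parametrised `k`-element blocks in `α`, any two distinct ones
meeting in at most one point. -/
def HasPacking (k b : ℕ) (α : Type) : Prop :=
  ∃ f : Fin b → Fin k → α, (∀ i, Function.Injective (f i)) ∧
    ∀ i j u u' v v', u ≠ v → f i u = f j u' → f i v = f j v' → i = j

theorem HasPacking.of_fintype {k : ℕ} {α I : Type} [Fintype I] (f : I → Fin k → α)
    (hinj : ∀ i, Function.Injective (f i))
    (hlin : ∀ i j u u' v v', u ≠ v → f i u = f j u' → f i v = f j v' → i = j) :
    HasPacking k (Fintype.card I) α := by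
  let e := (Fintype.equivFin I).symm
  refine ⟨fun i => f (e i), fun i => hinj _, ?_⟩
  intro i j u u' v v' huv h1 h2
  exact e.injective (hlin _ _ _ _ _ _ huv h1 h2)

theorem HasPacking.map {k b : ℕ} {α β : Type} (h : HasPacking k b α) (g : α ↪ β) :
    HasPacking k b β := by
  obtain ⟨f, hinj, hlin⟩ := h
  refine ⟨fun i u => g (f i u), fun i => g.injective.comp (hinj i), ?_⟩
  intro i j u u' v v' huv h1 h2
  exact hlin _ _ _ _ _ _ huv (g.injective h1) (g.injective h2)

theorem isUnit_natCast_sub {k t : ℕ} {i j : Fin k} (hij : i ≠ j) :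
    IsUnit (((i : ℕ) : ZMod (1 + k.factorial * t)) - ((j : ℕ) : ZMod (1 + k.factorial * t))) := by
  have key : ∀ i j : Fin k, j < i → IsUnit
      (((i : ℕ) : ZMod (1 + k.factorial * t)) - ((j : ℕ) : ZMod (1 + k.factorial * t))) := by
    intro i j hji
    have hji' : (j : ℕ) < i := hji
    rw [← Nat.cast_sub hji'.le, ZMod.isUnit_iff_coprime]
    obtain ⟨c, hc⟩ : (i : ℕ) - j ∣ k.factorial :=
      Nat.dvd_factorial (by omega) (by have := i.isLt; omega)
    rw [hc, mul_assoc]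
    simp
  rcases lt_or_gt_of_ne hij with h | h
  · rw [← neg_sub]
    exact (key j i h).neg
  · exact key i j h

/-- A transversal design on `k` groups, with a packing placed inside each group. -/
theorem HasPacking.transversal {k b t : ℕ}
    (h : HasPacking k b (Fin (1 + k.factorial * t))) :
    HasPacking k ((1 + k.factorial * t) ^ 2 + k * b)
      (Fin k × ZMod (1 + k.factorial * t)) := by
  have : NeZero (1 + k.factorial * t) := ⟨by omega⟩
  obtain ⟨f, hinj, hlin⟩ := h.map (ZMod.finEquiv (1 + k.factorial * t)).toEquiv.toEmbedding
  have key := HasPacking.of_fintype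
    (I := (ZMod (1 + k.factorial * t) × ZMod (1 + k.factorial * t)) ⊕ (Fin k × Fin b))
    (k := k) (α := Fin k × ZMod (1 + k.factorial * t))
    (fun s u => match s with
      | Sum.inl p => (u, p.1 * ((u : ℕ) : ZMod (1 + k.factorial * t)) + p.2)
      | Sum.inr q => (q.1, f q.2 u)) ?_ ?_
  · convert key using 1
    simp [ZMod.card, sq]
  · rintro (p | q) u v huv
    · exact (Prod.ext_iff.1 huv).1
    · exact hinj _ (Prod.ext_iff.1 huv).2
  · rintro (⟨a, b⟩ | ⟨g, i⟩) (⟨a', b'⟩ | ⟨g', i'⟩) u u' v v' huv h1 h2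
    · simp only [Prod.mk.injEq] at h1 h2
      obtain ⟨rfl, h1⟩ := h1
      obtain ⟨rfl, h2⟩ := h2
      have hu := isUnit_natCast_sub (t := t) huv
      have h3 : (a - a') * (((u : ℕ) : ZMod (1 + k.factorial * t)) -
          ((v : ℕ) : ZMod (1 + k.factorial * t))) = 0 := by
        linear_combination h1 - h2
      have h4 : a = a' := sub_eq_zero.1 (hu.mul_left_eq_zero.1 h3)
      subst h4
      simpa using h1
    · simp only [Prod.mk.injEq] at h1 h2
      exact absurd (h1.1.trans h2.1.symm) huv
    · simp only [Prod.mk.injEq] at h1 h2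
      have huv' : u' = v' := h1.1.symm.trans h2.1
      subst huv'
      exact absurd (hinj _ (h1.2.trans h2.2.symm)) huv
    · simp only [Prod.mk.injEq] at h1 h2
      have := hlin _ _ _ _ _ _ huv h1.2 h2.2
      simp [this, h1.1]

theorem hasPacking_zero (k : ℕ) (α : Type) : HasPacking k 0 α :=
  ⟨fun i => i.elim0, fun i => i.elim0, fun i => i.elim0⟩

/-- `K_n` can be packed with copies of `K_k` covering all but `o(n²)` of its edges. -/
theorem exists_hasPacking (k : ℕ) (hk : 2 ≤ k) (ε : ℝ) (hε : 0 < ε) :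
    ∃ A : ℝ, 0 ≤ A ∧ ∀ n : ℕ, ∃ b : ℕ, HasPacking k b (Fin n) ∧
      (1 - ε) * (n : ℝ) ^ 2 - A * n ≤ k * (k - 1) * b := by
  obtain ⟨A, hA⟩ := exists_nat_ge (4 * ((k : ℝ) * (k.factorial + 1)) / ε)
  have hkR : (2 : ℝ) ≤ k := by exact_mod_cast hk
  have hL : 0 < k.factorial := Nat.factorial_pos k
  refine ⟨(A + k : ℕ), by positivity, ?_⟩
  intro n
  induction n using Nat.strong_induction_on with
  | _ n ih =>
  by_cases hn : n < A + k
  · refine ⟨0, hasPacking_zero _ _, ?_⟩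
    have h1 : (n : ℝ) ≤ (A + k : ℕ) := by exact_mod_cast hn.le
    have h2 : (0 : ℝ) ≤ n := by positivity
    simp only [Nat.cast_zero, mul_zero]
    nlinarith [mul_nonneg hε.le (sq_nonneg (n : ℝ))]
  · push Not at hn
    set t := (n / k - 1) / k.factorial with ht
    have hdiv : 1 ≤ n / k := (Nat.one_le_div_iff (by omega)).2 (by omega)
    have hle : k.factorial * t ≤ n / k - 1 := Nat.mul_div_le _ _
    have hlt : n / k - 1 < k.factorial * (t + 1) := Nat.lt_mul_div_succ _ hL
    have hn1 : k * (n / k) ≤ n := Nat.mul_div_le _ _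
    have hn2 : n < k * (n / k + 1) := Nat.lt_mul_div_succ _ (by omega)
    have hN1 : k * (1 + k.factorial * t) ≤ n :=
      (Nat.mul_le_mul_left k (by omega)).trans hn1
    have hN2 : n ≤ k * (1 + k.factorial * t) + k * (k.factorial + 1) := by
      refine hn2.le.trans ?_
      rw [← mul_add]
      refine Nat.mul_le_mul_left k ?_
      rw [mul_add] at hlt
      omega
    have hNn : 1 + k.factorial * t < n := by nlinarith
    obtain ⟨b, hb, hbound⟩ := ih _ hNn
    have : NeZero (1 + k.factorial * t) := ⟨by omega⟩
    have hcard : Fintype.card (Fin k × ZMod (1 + k.factorial * t)) ≤ Fintype.card (Fin n) := by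
      simpa [ZMod.card] using hN1
    obtain ⟨g⟩ := Function.Embedding.nonempty_of_card_le hcard
    refine ⟨_, hb.transversal.map g, ?_⟩
    have hN1R : (k : ℝ) * (1 + k.factorial * t : ℕ) ≤ n := by exact_mod_cast hN1
    have hN2R : (n : ℝ) ≤ (k : ℝ) * (1 + k.factorial * t : ℕ) + k * (k.factorial + 1) := by
      exact_mod_cast hN2
    have hAn : 4 * ((k : ℝ) * (k.factorial + 1)) ≤ ε * n := by
      rw [div_le_iff₀ hε] at hA
      have : (A : ℝ) ≤ n := by exact_mod_cast (by omega : A ≤ n)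
      nlinarith
    rw [Nat.cast_add ((1 + k.factorial * t) ^ 2), Nat.cast_mul, Nat.cast_pow]
    have hN0 : (0 : ℝ) ≤ (1 + k.factorial * t : ℕ) := by positivity
    generalize ((1 + k.factorial * t : ℕ) : ℝ) = N at *
    generalize (k : ℝ) * (k.factorial + 1) = c at *
    have hA0 : (0 : ℝ) ≤ (A + k : ℕ) := by positivity
    generalize ((A + k : ℕ) : ℝ) = A' at *
    have hn0 : (0 : ℝ) ≤ n := by positivity
    generalize (n : ℝ) = x at *
    generalize (b : ℝ) = y at *
    generalize (k : ℝ) = q at *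
    have e1 : q * ((1 - ε) * N ^ 2 - A' * N) ≤ q * (q * (q - 1) * y) :=
      mul_le_mul_of_nonneg_left hbound (by linarith)
    have e2 : A' * (q * N) ≤ A' * x := mul_le_mul_of_nonneg_left hN1R hA0
    have e3 : x ^ 2 - 2 * c * x ≤ (q * N) ^ 2 := by
      nlinarith [sq_nonneg (x - q * N), mul_nonneg hn0 (sub_nonneg.2 hN2R)]
    have e4 : 4 * c * x ≤ ε * x ^ 2 := by nlinarith
    have e5 : (q * N) ^ 2 ≤ x ^ 2 := pow_le_pow_left₀ (by positivity) hN1R 2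
    have e6 : 2 * (q * N ^ 2) ≤ (q * N) ^ 2 := by
      nlinarith [mul_nonneg (mul_nonneg (sub_nonneg.2 hkR) (by linarith : 0 ≤ q)) (sq_nonneg N)]
    have e7 : ε * (2 * (q * N ^ 2)) ≤ ε * x ^ 2 := mul_le_mul_of_nonneg_left (e6.trans e5) hε.le
    linarith

/-- The standard one-factorisation of `K_{2m}`. -/
theorem exists_oneFactorization (m : ℕ) (hm : 1 ≤ m) :
    ∃ g : Fin (2 * m) → Fin (2 * m) → Fin (2 * m - 1), (∀ u v, g u v = g v u) ∧
      ∀ u v v', u ≠ v → u ≠ v' → v ≠ v' → g u v ≠ g u v' := by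
  have : NeZero (2 * m - 1) := ⟨by omega⟩
  let e₁ : Fin (2 * m) ≃ Option (ZMod (2 * m - 1)) :=
    Fintype.equivOfCardEq (by simp [ZMod.card]; omega)
  let e₂ : ZMod (2 * m - 1) ≃ Fin (2 * m - 1) := Fintype.equivOfCardEq (by simp [ZMod.card])
  have h2 : IsUnit (2 : ZMod (2 * m - 1)) := by
    have : IsUnit ((2 : ℕ) : ZMod (2 * m - 1)) := by
      rw [ZMod.isUnit_iff_coprime, Nat.coprime_two_left]
      exact ⟨m - 1, by omega⟩
    simpa using this
  let h : Option (ZMod (2 * m - 1)) → Option (ZMod (2 * m - 1)) → ZMod (2 * m - 1) :=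
    fun x y => match x, y with
      | some a, some b => a + b
      | some a, none => 2 * a
      | none, some a => 2 * a
      | none, none => 0
  have hsymm : ∀ x y, h x y = h y x := by
    rintro (_ | a) (_ | b) <;> simp [h, add_comm]
  have hproper : ∀ x y y', x ≠ y → x ≠ y' → y ≠ y' → h x y ≠ h x y' := by
    rintro (_ | a) (_ | b) (_ | b') h1 h2' h3
    all_goals simp only [ne_eq, Option.some.injEq, not_true_eq_false] at h1 h2' h3
    · simpa [h, h2.mul_right_inj] using h3
    · simpa [h, two_mul] using h2'
    · simpa [h, two_mul, eq_comm] using h1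
    · simpa [h] using h3
  refine ⟨fun u v => e₂ (h (e₁ u) (e₁ v)), fun u v => by simp [hsymm], ?_⟩
  intro u v v' h1 h2 h3 h4
  exact hproper _ _ _ (e₁.injective.ne h1) (e₁.injective.ne h2) (e₁.injective.ne h3)
    (e₂.injective h4)

open Classical in
/-- The block colouring: edges inside block `i` are coloured by `g` with a palette private to
`i`, all other edges get a colour of their own. -/
theorem exists_blockColoring {n k b r : ℕ} (f : Fin b → Fin k → Fin n)
    (hinj : ∀ i, Function.Injective (f i))
    (hlin : ∀ i j u u' v v', u ≠ v → f i u = f j u' → f i v = f j v' → i = j)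
    (g : Fin k → Fin k → Fin r) (hsymm : ∀ u v, g u v = g v u) :
    ∃ C : Fin n → Fin n → (Fin b × Fin r) ⊕ Sym2 (Fin n),
      (∀ x y, C x y = C y x) ∧
      (∀ x y p, C x y = Sum.inl p → ∃ u v, u ≠ v ∧ f p.1 u = x ∧ f p.1 v = y ∧ p.2 = g u v) ∧
      (∀ x y e, C x y = Sum.inr e → e = s(x, y) ∧
        ¬ ∃ i u v, u ≠ v ∧ f i u = x ∧ f i v = y) := by
  let C : Fin n → Fin n → (Fin b × Fin r) ⊕ Sym2 (Fin n) := fun x y =>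
    if h : ∃ p : Fin b × Fin k × Fin k, p.2.1 ≠ p.2.2 ∧ f p.1 p.2.1 = x ∧ f p.1 p.2.2 = y
    then Sum.inl (h.choose.1, g h.choose.2.1 h.choose.2.2) else Sum.inr s(x, y)
  have hC : ∀ i u v, u ≠ v → C (f i u) (f i v) = Sum.inl (i, g u v) := by
    intro i u v huv
    have h : ∃ p : Fin b × Fin k × Fin k,
        p.2.1 ≠ p.2.2 ∧ f p.1 p.2.1 = f i u ∧ f p.1 p.2.2 = f i v := ⟨(i, u, v), huv, rfl, rfl⟩
    have hs := h.choose_spec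
    have hi : h.choose.1 = i := hlin _ _ _ _ _ _ hs.1 hs.2.1 hs.2.2
    have h1 := hs.2.1
    have h2 := hs.2.2
    have hu : h.choose.2.1 = u := hinj i ((congrFun (congrArg f hi) _).symm.trans h1)
    have hv : h.choose.2.2 = v := hinj i ((congrFun (congrArg f hi) _).symm.trans h2)
    simp only [C, dif_pos h, hi, hu, hv]
  have hC' : ∀ x y, (¬ ∃ i u v, u ≠ v ∧ f i u = x ∧ f i v = y) → C x y = Sum.inr s(x, y) := by
    intro x y h
    refine dif_neg ?_
    rintro ⟨p, hp⟩
    exact h ⟨_, _, _, hp⟩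
  refine ⟨C, ?_, ?_, ?_⟩
  · intro x y
    by_cases h : ∃ i u v, u ≠ v ∧ f i u = x ∧ f i v = y
    · obtain ⟨i, u, v, huv, rfl, rfl⟩ := h
      rw [hC _ _ _ huv, hC _ _ _ huv.symm, hsymm]
    · have h' : ¬ ∃ i u v, u ≠ v ∧ f i u = y ∧ f i v = x := by
        rintro ⟨i, u, v, huv, h1, h2⟩
        exact h ⟨i, v, u, huv.symm, h2, h1⟩
      rw [hC' _ _ h, hC' _ _ h', Sym2.eq_swap]
  · intro x y p hp
    by_cases h : ∃ i u v, u ≠ v ∧ f i u = x ∧ f i v = y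
    · obtain ⟨i, u, v, huv, rfl, rfl⟩ := h
      rw [hC _ _ _ huv, Sum.inl.injEq] at hp
      subst hp
      exact ⟨u, v, huv, rfl, rfl, rfl⟩
    · rw [hC' _ _ h] at hp
      cases hp
  · intro x y e he
    by_cases h : ∃ i u v, u ≠ v ∧ f i u = x ∧ f i v = y
    · obtain ⟨i, u, v, huv, rfl, rfl⟩ := h
      rw [hC _ _ _ huv] at he
      cases he
    · rw [hC' _ _ h, Sum.inr.injEq] at he
      exact ⟨he.symm, h⟩

open Classical in
theorem card_uncovered_add_le {n k b : ℕ} (f : Fin b → Fin k → Fin n)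
    (hinj : ∀ i, Function.Injective (f i))
    (hlin : ∀ i j u u' v v', u ≠ v → f i u = f j u' → f i v = f j v' → i = j)
    (L : Finset (Sym2 (Fin n)))
    (hL : ∀ e ∈ L, ¬ e.IsDiag ∧ ∀ i (e' : Sym2 (Fin k)), ¬ e'.IsDiag → e'.map (f i) ≠ e) :
    L.card + b * k.choose 2 ≤ n.choose 2 := by
  let F : Fin b × {e : Sym2 (Fin k) // ¬ e.IsDiag} → Sym2 (Fin n) := fun p => p.2.1.map (f p.1)
  have hF : Function.Injective F := by
    rintro ⟨i, ⟨e, he⟩⟩ ⟨j, ⟨e', he'⟩⟩ h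
    have hij : i = j := by
      induction e with | _ u v =>
      induction e' with | _ u' v' =>
      simp only [F, Sym2.map_mk, Sym2.eq_iff] at h
      have huv : u ≠ v := by simpa using he
      rcases h with h | h
      · exact hlin _ _ _ _ _ _ huv h.1 h.2
      · exact hlin _ _ _ _ _ _ huv h.1 h.2
    subst hij
    have := Sym2.map.injective (hinj i) h
    subst this
    rfl
  have hFd : ∀ p, ¬ (F p).IsDiag := by
    rintro ⟨i, ⟨e, he⟩⟩
    induction e with | _ u v =>
    simpa [F, (hinj i).eq_iff] using he
  have hdisj : Disjoint L (Finset.univ.image F) := by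
    rw [Finset.disjoint_left]
    rintro e he h
    obtain ⟨p, -, rfl⟩ := Finset.mem_image.1 h
    exact (hL _ he).2 p.1 p.2.1 p.2.2 rfl
  have hsub : L ∪ Finset.univ.image F ⊆ Finset.univ.filter fun e : Sym2 (Fin n) => ¬ e.IsDiag := by
    intro e he
    simp only [Finset.mem_filter, Finset.mem_univ, true_and]
    rcases Finset.mem_union.1 he with he | he
    · exact (hL _ he).1
    · obtain ⟨p, -, rfl⟩ := Finset.mem_image.1 he
      exact hFd p
  have hcard := Finset.card_le_card hsub
  rw [Finset.card_union_of_disjoint hdisj, Finset.card_image_of_injective _ hF,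
    ← Fintype.card_subtype, Sym2.card_subtype_not_diag, Finset.card_univ, Fintype.card_prod,
    Sym2.card_subtype_not_diag] at hcard
  simpa using hcard

theorem repeatNumber_add_le_of_hasPacking {V : Type} [Fintype V] (T : SimpleGraph V)
    (hT : T.Connected) {m n b : ℕ} (hm : 1 ≤ m) (hV : m + 1 ≤ Fintype.card V)
    (hb : HasPacking (2 * m) b (Fin n)) :
    repeatNumber 2 n T + b * (2 * m).choose 2 ≤ b * (2 * m - 1) + n.choose 2 := by
  classical
  obtain ⟨f, hinj, hlin⟩ := hb
  obtain ⟨g, gsymm, gproper⟩ := exists_oneFactorization m hm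
  obtain ⟨C, Csymm, Cl, Cr⟩ := exists_blockColoring f hinj hlin g gsymm
  obtain ⟨enc, henc⟩ := exists_injective_nat ((Fin b × Fin (2 * m - 1)) ⊕ Sym2 (Fin n))
  let c : Fin n → Fin n → ℕ := fun x y => enc (C x y)
  have hc : ∀ {x y z w}, c x y = c z w → C x y = C z w := fun h => henc h
  have hproper : IsProperEdgeColoring n c := by
    refine ⟨fun x y => by simp only [c, Csymm x y], ?_⟩
    intro x y y' hxy hxy' hyy' h
    have h := hc h
    rcases hp : C x y with p | e
    · obtain ⟨u, v, huv, hu, hv, hg⟩ := Cl _ _ _ hp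
      obtain ⟨u', v', huv', hu', hv', hg'⟩ := Cl _ _ _ (h.symm.trans hp)
      have := hinj _ (hu.trans hu'.symm)
      subst this
      refine gproper u v v' huv huv' ?_ (hg.symm.trans hg')
      rintro rfl
      exact hyy' (hv.symm.trans hv')
    · have h1 := (Cr _ _ _ hp).1
      have h2 := (Cr _ _ _ (h.symm.trans hp)).1
      rw [h1, Sym2.congr_right] at h2
      exact hyy' h2
  have hrep : ¬ HasRepeat n 2 T c := by
    rintro ⟨φ, φinj, φdisj, φcol⟩
    have hne : ∀ u v, φ 0 u ≠ φ 1 v := φdisj 0 1 (by decide)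
    let P : Fin b → V → Prop := fun i u => (∃ x, f i x = φ 0 u) ∧ ∃ x, f i x = φ 1 u
    have hadj : ∀ u v, T.Adj u v → ∃ i, P i u ∧ P i v := by
      intro u v huv
      have h := hc (φcol 0 1 u v huv)
      rcases hp : C (φ 0 u) (φ 0 v) with p | e
      · obtain ⟨x, y, -, hx, hy, -⟩ := Cl _ _ _ hp
        obtain ⟨x', y', -, hx', hy', -⟩ := Cl _ _ _ (h.symm.trans hp)
        exact ⟨p.1, ⟨⟨x, hx⟩, ⟨x', hx'⟩⟩, ⟨⟨y, hy⟩, ⟨y', hy'⟩⟩⟩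
      · have h1 := (Cr _ _ _ hp).1
        have h2 := (Cr _ _ _ (h.symm.trans hp)).1
        rw [h1, Sym2.eq_iff] at h2
        rcases h2 with h2 | h2
        · exact absurd h2.1 (hne _ _)
        · exact absurd h2.1 (hne _ _)
    have huniq : ∀ i j u, P i u → P j u → i = j := by
      rintro i j u ⟨⟨x, hx⟩, ⟨y, hy⟩⟩ ⟨⟨x', hx'⟩, ⟨y', hy'⟩⟩
      refine hlin i j x x' y y' ?_ (hx.trans hx'.symm) (hy.trans hy'.symm)
      rintro rfl
      exact hne u u (hx.symm.trans hy)
    have : Nontrivial V := Fintype.one_lt_card_iff_nontrivial.1 (by omega)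
    obtain ⟨u₀⟩ := hT.nonempty
    obtain ⟨v₀, hv₀⟩ := hT.preconnected.exists_adj_of_nontrivial u₀
    obtain ⟨i, hi, -⟩ := hadj _ _ hv₀
    have hall : ∀ v, P i v := by
      intro v
      obtain ⟨w⟩ := hT.preconnected v u₀
      induction w with
      | nil => exact hi
      | cons h _ ih =>
        obtain ⟨j, hj, hj'⟩ := hadj _ _ h
        have := huniq _ _ _ (ih hv₀ hi) hj'
        rwa [this]
    choose a ha using fun v => (hall v).1
    choose a' ha' using fun v => (hall v).2
    have hs : Function.Injective (Sum.elim a a') := by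
      rintro (u | u) (v | v) huv
      · simp only [Sum.elim_inl] at huv
        exact congrArg _ (φinj 0 (by rw [← ha, ← ha, huv]))
      · simp only [Sum.elim_inl, Sum.elim_inr] at huv
        exact absurd (by rw [← ha, ← ha', huv]) (hne u v)
      · simp only [Sum.elim_inl, Sum.elim_inr] at huv
        exact absurd (by rw [← ha, ← ha', huv]) (hne v u)
      · simp only [Sum.elim_inr] at huv
        exact congrArg _ (φinj 1 (by rw [← ha', ← ha', huv]))
    have := Fintype.card_le_of_injective _ hs
    simp only [Fintype.card_sum, Fintype.card_fin] at this
    omega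
  have hle : repeatNumber 2 n T ≤ numColors n c := Nat.sInf_le ⟨c, hproper, rfl, hrep⟩
  let L : Finset (Sym2 (Fin n)) :=
    Finset.univ.filter fun e => ¬ e.IsDiag ∧
      ∀ i (e' : Sym2 (Fin (2 * m))), ¬ e'.IsDiag → e'.map (f i) ≠ e
  have hL : L.card + b * (2 * m).choose 2 ≤ n.choose 2 :=
    card_uncovered_add_le f hinj hlin L fun e he => (Finset.mem_filter.1 he).2
  have hcol : numColors n c ≤ b * (2 * m - 1) + L.card := by
    have hsub : ((Finset.univ.filter fun p : Fin n × Fin n => p.1 ≠ p.2).image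
        fun p => c p.1 p.2) ⊆
        (Finset.univ.image fun p : Fin b × Fin (2 * m - 1) => enc (Sum.inl p)) ∪
          L.image fun e => enc (Sum.inr e) := by
      intro x hx
      obtain ⟨⟨y, z⟩, hyz, rfl⟩ := Finset.mem_image.1 hx
      have hyz : y ≠ z := (Finset.mem_filter.1 hyz).2
      rw [Finset.mem_union]
      rcases hp : C y z with p | e
      · left
        exact Finset.mem_image.2 ⟨p, Finset.mem_univ _, by simp only [c, hp]⟩
      · right
        refine Finset.mem_image.2 ⟨e, ?_, by simp only [c, hp]⟩
        obtain ⟨rfl, hcov⟩ := Cr _ _ _ hp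
        refine Finset.mem_filter.2 ⟨Finset.mem_univ _, by simpa using hyz, ?_⟩
        intro i e' he' h
        induction e' with | _ u v =>
        have huv : u ≠ v := by simpa using he'
        rw [Sym2.map_mk, Sym2.eq_iff] at h
        rcases h with h | h
        · exact hcov ⟨i, u, v, huv, h⟩
        · exact hcov ⟨i, v, u, huv.symm, h.2, h.1⟩
    refine (Finset.card_le_card hsub).trans ((Finset.card_union_le _ _).trans ?_)
    refine Nat.add_le_add (Finset.card_image_le.trans ?_) Finset.card_image_le
    simp
  omega

/-- For every tree `T` with `m ≥ 2` edges, `f₂(n,T) ≤ (1 + o(1))·n²/(2m)`. -/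
theorem stmt_17 (V : Type) [Fintype V] [DecidableEq V] (T : SimpleGraph V)
    [DecidableRel T.Adj] (hT : T.IsTree) (m : ℕ) (hm : 2 ≤ m)
    (hme : T.edgeFinset.card = m) :
    ∀ ε : ℝ, 0 < ε → ∃ n₀ : ℕ, ∀ n ≥ n₀,
      (repeatNumber 2 n T : ℝ) ≤ (1 + ε) * (n : ℝ) ^ 2 / (2 * (m : ℝ)) := by
  intro ε hε
  have hm0 : (0 : ℝ) < m := by exact_mod_cast (by omega : 0 < m)
  have hm1 : (1 : ℝ) ≤ m := by exact_mod_cast (by omega : 1 ≤ m)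
  obtain ⟨A, hA, hpack⟩ :=
    exists_hasPacking (2 * m) (by omega) (ε / (2 * m)) (by positivity)
  obtain ⟨n₀, hn₀⟩ := exists_nat_ge (2 * m * A / ε)
  refine ⟨n₀, fun n hn => ?_⟩
  obtain ⟨b, hb, hbound⟩ := hpack n
  have hV : T.edgeFinset.card + 1 = Fintype.card V := hT.card_edgeFinset
  have key := repeatNumber_add_le_of_hasPacking T hT.connected (by omega : 1 ≤ m)
    (by omega) hb
  have keyR : (repeatNumber 2 n T : ℝ) + b * ((2 * m) * (2 * m - 1) / 2) ≤
      b * (2 * m - 1) + n * (n - 1) / 2 := by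
    have h : ((repeatNumber 2 n T + b * (2 * m).choose 2 : ℕ) : ℝ) ≤
        (b * (2 * m - 1) + n.choose 2 : ℕ) := by exact_mod_cast key
    push_cast [Nat.cast_choose_two, Nat.cast_sub (by omega : 1 ≤ 2 * m)] at h
    exact h
  have hnR : 2 * m * A ≤ ε * n := by
    have : (n₀ : ℝ) ≤ n := by exact_mod_cast hn
    rw [div_le_iff₀ hε] at hn₀
    nlinarith
  push_cast at hbound
  have hn0 : (0 : ℝ) ≤ n := by positivity
  generalize (repeatNumber 2 n T : ℝ) = R at *
  rw [le_div_iff₀ (by positivity)]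
  obtain ⟨δ, rfl⟩ : ∃ δ, ε = 2 * m * δ := ⟨ε / (2 * m), by field_simp⟩
  have hδ : 2 * m * δ / (2 * m) = δ := by field_simp
  rw [hδ] at hbound
  have hA' : A ≤ δ * n := by nlinarith
  have hδ0 : 0 < δ := by nlinarith
  have e1 : (m - 1) * ((1 - δ) * (n : ℝ) ^ 2 - A * n) ≤ (m - 1) * (2 * m * (2 * m - 1) * b) :=
    mul_le_mul_of_nonneg_left hbound (by linarith)
  have e2 : (m - 1 : ℝ) * (A * n) ≤ (m - 1) * (δ * n ^ 2) :=
    mul_le_mul_of_nonneg_left (by nlinarith) (by linarith)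
  have e3 := mul_le_mul_of_nonneg_left keyR (by positivity : (0 : ℝ) ≤ 2 * m)
  have e4 : 0 ≤ δ * (n : ℝ) ^ 2 := by positivity
  have e5 : 0 ≤ (m : ℝ) * n := by positivity
  linarith
end
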